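/- For every positive integer n, there are infinitely many positive integers x such that d(x) = d(x + n), where d denotes the number-of-divisors function. -/

import Mathlib

open Finset

/-- The primes `p` with `a < p ≤ b`. -/
def primesBetween (a b : ℕ) : Finset ℕ := (Ioc a b).filter Nat.Prime

lemma mem_primesBetween {a b p : ℕ} : p ∈ primesBetween a b ↔ (a < p ∧ p ≤ b) ∧ p.Prime := by
  simp [primesBetween]

lemma primesBetween_union {a b c : ℕ} (hab : a ≤ b) (hbc : b ≤ c) :
    primesBetween a c = primesBetween a b ∪ primesBetween b c := by
  rw [primesBetween, primesBetween, primesBetween, ← filter_union, Ioc_union_Ioc_eq_Ioc hab hbc]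

lemma disjoint_primesBetween (a b c : ℕ) :
    Disjoint (primesBetween a b) (primesBetween b c) := by
  rw [Finset.disjoint_left]
  intro p hp hp'
  rw [mem_primesBetween] at hp hp'
  omega

lemma sum_inv_primesBetween_dyadic {e : ℕ} (he : 0 < e) :
    ∑ p ∈ primesBetween (2 ^ e) (2 ^ (e + 1)), (1 / p : ℝ) ≤ 4 / e := by
  set Q := primesBetween (2 ^ e) (2 ^ (e + 1))
  have h1 : (2 ^ e) ^ #Q ≤ ∏ p ∈ Q, p := by
    apply Finset.pow_card_le_prod
    intro p hp
    exact (mem_primesBetween.1 hp).1.1.le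
  have h2 : ∏ p ∈ Q, p ≤ primorial (2 ^ (e + 1)) := by
    unfold primorial
    apply Finset.prod_le_prod_of_subset_of_one_le'
    · intro p hp
      have := mem_primesBetween.1 hp
      simp only [mem_filter, mem_range]
      exact ⟨by omega, this.2⟩
    · intro p hp _
      exact (mem_filter.1 hp).2.one_le
  have h3 : 2 ^ (e * #Q) ≤ 2 ^ (2 * 2 ^ (e + 1)) := by
    calc 2 ^ (e * #Q) = (2 ^ e) ^ #Q := by rw [pow_mul]
      _ ≤ 4 ^ (2 ^ (e + 1)) := h1.trans (h2.trans (primorial_le_four_pow _))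
      _ = 2 ^ (2 * 2 ^ (e + 1)) := by rw [pow_mul]; norm_num
  have h4 : e * #Q ≤ 2 * 2 ^ (e + 1) := (Nat.pow_le_pow_iff_right (by norm_num)).1 h3
  have h5 : (e : ℝ) * #Q ≤ 4 * 2 ^ e := by
    have : ((e * #Q : ℕ) : ℝ) ≤ ((2 * 2 ^ (e + 1) : ℕ) : ℝ) := by exact_mod_cast h4
    push_cast at this
    rw [pow_succ] at this
    linarith
  have he' : (0 : ℝ) < e := by exact_mod_cast he
  calc ∑ p ∈ Q, (1 / p : ℝ) ≤ ∑ p ∈ Q, (1 / 2 ^ e : ℝ) := by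
        apply sum_le_sum
        intro p hp
        have : (2 : ℝ) ^ e ≤ p := by exact_mod_cast (mem_primesBetween.1 hp).1.1.le
        gcongr
    _ = #Q / 2 ^ e := by rw [sum_const, nsmul_eq_mul]; ring
    _ ≤ 4 / e := by
        rw [div_le_div_iff₀ (by positivity) he']
        linarith

lemma sum_inv_primesBetween_pow_add {E : ℕ} (hE : 0 < E) (t : ℕ) :
    ∑ p ∈ primesBetween (2 ^ E) (2 ^ (E + t)), (1 / p : ℝ) ≤ t * (4 / E) := by
  induction t with
  | zero => simp [primesBetween]
  | succ t ih =>
    rw [primesBetween_union (b := 2 ^ (E + t)) (by gcongr <;> omega) (by gcongr <;> omega),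
      sum_union (disjoint_primesBetween _ _ _)]
    have h := sum_inv_primesBetween_dyadic (e := E + t) (by omega)
    have hE' : (0 : ℝ) < E := by exact_mod_cast hE
    have h' : (4 : ℝ) / ((E + t : ℕ) : ℝ) ≤ 4 / E := by
      gcongr
      omega
    rw [← add_assoc]
    push_cast at *
    linarith

/-- A Mertens-type bound: primes between `w` and `w ^ 2` have bounded sum of reciprocals. -/
lemma sum_inv_primesBetween_sq {E : ℕ} (hE : 0 < E) :
    ∑ p ∈ primesBetween (2 ^ E) (2 ^ (2 * E)), (1 / p : ℝ) ≤ 4 := by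
  have h := sum_inv_primesBetween_pow_add hE E
  have hE' : (0 : ℝ) < E := by exact_mod_cast hE
  rw [two_mul]
  calc _ ≤ _ := h
    _ = 4 := by field_simp

lemma sum_inv_primesBetween_iterate {E : ℕ} (hE : 0 < E) (s : ℕ) :
    ∑ p ∈ primesBetween (2 ^ E) (2 ^ (E * 2 ^ s)), (1 / p : ℝ) ≤ 4 * s := by
  induction s with
  | zero => simp [primesBetween]
  | succ s ih =>
    have h := sum_inv_primesBetween_sq (E := E * 2 ^ s) (by positivity)
    rw [primesBetween_union (b := 2 ^ (E * 2 ^ s))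
      (Nat.pow_le_pow_right (by norm_num) (Nat.le_mul_of_pos_right _ (by positivity)))
      (Nat.pow_le_pow_right (by norm_num) (by rw [pow_succ]; gcongr; omega)),
      sum_union (disjoint_primesBetween _ _ _)]
    rw [show E * 2 ^ (s + 1) = 2 * (E * 2 ^ s) by ring]
    push_cast
    linarith

/-- The elementary symmetric sum of degree `k` of the numbers `g p`, `p ∈ Q`. -/
def elemSum (Q : Finset ℕ) (k : ℕ) (g : ℕ → ℝ) : ℝ := ∑ s ∈ Q.powersetCard k, ∏ p ∈ s, g p

lemma elemSum_zero (Q : Finset ℕ) (g : ℕ → ℝ) : elemSum Q 0 g = 1 := by simp [elemSum]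

lemma elemSum_insert {Q : Finset ℕ} {q : ℕ} (hq : q ∉ Q) (k : ℕ) (g : ℕ → ℝ) :
    elemSum (insert q Q) (k + 1) g = elemSum Q (k + 1) g + g q * elemSum Q k g := by
  unfold elemSum
  have hns : ∀ s ∈ powersetCard k Q, q ∉ s := fun _ hs h => hq ((mem_powersetCard.1 hs).1 h)
  rw [powersetCard_succ_insert hq, sum_union, sum_image, mul_sum]
  · congr 1
    exact sum_congr rfl fun s hs => prod_insert (hns s hs)
  · intro s hs s' hs' h
    rw [← erase_insert (hns s hs), ← erase_insert (hns s' hs'), h]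
  · rw [Finset.disjoint_left]
    intro s hs hs'
    obtain ⟨s', _, rfl⟩ := mem_image.1 hs'
    exact hq ((mem_powersetCard.1 hs).1 (mem_insert_self _ _))

lemma elemSum_nonneg {Q : Finset ℕ} {g : ℕ → ℝ} (hg : ∀ p ∈ Q, 0 ≤ g p) (k : ℕ) :
    0 ≤ elemSum Q k g :=
  sum_nonneg fun _ hs => prod_nonneg fun p hp => hg p ((mem_powersetCard.1 hs).1 hp)

/-- The Bonferroni inequalities for the inclusion-exclusion formula. -/
lemma abs_prod_one_sub_sub_le {Q : Finset ℕ} {g : ℕ → ℝ} (h0 : ∀ p ∈ Q, 0 ≤ g p)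
    (h1 : ∀ p ∈ Q, g p ≤ 1) (m : ℕ) :
    |∏ p ∈ Q, (1 - g p) - ∑ k ∈ range m, (-1) ^ k * elemSum Q k g| ≤ elemSum Q m g := by
  induction Q using Finset.induction_on generalizing m with
  | empty =>
    cases m with
    | zero => simp [elemSum]
    | succ m =>
      have h : ∀ k, elemSum ∅ (k + 1) g = 0 := fun k => by
        rw [elemSum, powersetCard_eq_empty.2 (by simp), sum_empty]
      rw [sum_range_succ']
      simp [h, elemSum_zero]
  | insert q Q hq ih =>
    have h0' : ∀ p ∈ Q, 0 ≤ g p := fun p hp => h0 p (mem_insert_of_mem hp)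
    have h1' : ∀ p ∈ Q, g p ≤ 1 := fun p hp => h1 p (mem_insert_of_mem hp)
    have hq0 := h0 q (mem_insert_self _ _)
    cases m with
    | zero =>
      simp only [range_zero, sum_empty, sub_zero, elemSum_zero]
      rw [abs_of_nonneg (prod_nonneg fun p hp => sub_nonneg.2 (h1 p hp))]
      exact prod_le_one (fun p hp => sub_nonneg.2 (h1 p hp)) fun p hp => by linarith [h0 p hp]
    | succ m =>
      have key : ∏ p ∈ insert q Q, (1 - g p) -
          ∑ k ∈ range (m + 1), (-1) ^ k * elemSum (insert q Q) k g =
          (∏ p ∈ Q, (1 - g p) - ∑ k ∈ range (m + 1), (-1) ^ k * elemSum Q k g) -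
          g q * (∏ p ∈ Q, (1 - g p) - ∑ k ∈ range m, (-1) ^ k * elemSum Q k g) := by
        rw [prod_insert hq, sum_range_succ', sum_range_succ' _ m]
        simp only [elemSum_insert hq, elemSum_zero]
        have : ∑ k ∈ range m, (-1 : ℝ) ^ (k + 1) * (elemSum Q (k + 1) g + g q * elemSum Q k g) =
            ∑ k ∈ range m, (-1 : ℝ) ^ (k + 1) * elemSum Q (k + 1) g -
            g q * ∑ k ∈ range m, (-1 : ℝ) ^ k * elemSum Q k g := by
          rw [mul_sum, ← sum_sub_distrib]
          exact sum_congr rfl fun k _ => by ring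
        rw [this]
        ring
      rw [key, elemSum_insert hq]
      refine (abs_sub _ _).trans (add_le_add (ih h0' h1' _) ?_)
      rw [abs_mul, abs_of_nonneg hq0]
      exact mul_le_mul_of_nonneg_left (ih h0' h1' _) hq0

lemma sum_elemSum_le {Q : Finset ℕ} {g : ℕ → ℝ} (h0 : ∀ p ∈ Q, 0 ≤ g p) (m : ℕ) :
    ∑ k ∈ range m, elemSum Q k g ≤ ∏ p ∈ Q, (1 + g p) := by
  rw [prod_one_add, sum_powerset]
  calc ∑ k ∈ range m, elemSum Q k g
      ≤ ∑ k ∈ range (max m (#Q + 1)), elemSum Q k g :=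
        sum_le_sum_of_subset_of_nonneg (range_mono (le_max_left _ _))
          fun k _ _ => elemSum_nonneg h0 k
    _ = ∑ k ∈ range (#Q + 1), elemSum Q k g := by
        symm
        apply sum_subset (range_mono (le_max_right _ _))
        intro k _ hk
        rw [mem_range, not_lt] at hk
        rw [elemSum, powersetCard_eq_empty.2 (by omega), sum_empty]

lemma elemSum_le {Q : Finset ℕ} {g : ℕ → ℝ} (h0 : ∀ p ∈ Q, 0 ≤ g p) {c : ℝ} (hc : 0 < c)
    (m : ℕ) : elemSum Q m g ≤ c⁻¹ ^ m * ∏ p ∈ Q, (1 + c * g p) := by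
  have h : c ^ m * elemSum Q m g = elemSum Q m (fun p => c * g p) := by
    unfold elemSum
    rw [mul_sum]
    refine sum_congr rfl fun s hs => ?_
    rw [prod_mul_distrib, prod_const, (mem_powersetCard.1 hs).2]
  have h0' : ∀ p ∈ Q, 0 ≤ c * g p := fun p hp => mul_nonneg hc.le (h0 p hp)
  have h' : elemSum Q m (fun p => c * g p) ≤ ∏ p ∈ Q, (1 + c * g p) :=
    (single_le_sum (f := fun k => elemSum Q k (fun p => c * g p))
      (fun k _ => elemSum_nonneg h0' k) (self_mem_range_succ m)).trans (sum_elemSum_le h0' _)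
  rw [inv_pow, inv_mul_eq_div, le_div_iff₀ (by positivity), mul_comm, h]
  exact h'

lemma prod_one_add_le_four_pow {Q : Finset ℕ} {g : ℕ → ℝ} (h0 : ∀ p ∈ Q, 0 ≤ g p) {H : ℕ}
    (hH : ∑ p ∈ Q, g p ≤ H) : ∏ p ∈ Q, (1 + g p) ≤ 4 ^ H := by
  calc ∏ p ∈ Q, (1 + g p) ≤ ∏ p ∈ Q, Real.exp (g p) := by
        refine prod_le_prod (fun p hp => by linarith [h0 p hp]) fun p _ => ?_
        linarith [Real.add_one_le_exp (g p)]
    _ = Real.exp (∑ p ∈ Q, g p) := (Real.exp_sum _ _).symm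
    _ ≤ Real.exp H := Real.exp_le_exp.2 hH
    _ = Real.exp 1 ^ H := by rw [← Real.exp_nat_mul, mul_one]
    _ ≤ 4 ^ H := by
        gcongr
        linarith [Real.exp_one_lt_d9]

lemma one_le_four_pow_mul_prod {Q : Finset ℕ} {g : ℕ → ℝ} (h0 : ∀ p ∈ Q, 0 ≤ g p)
    (h1 : ∀ p ∈ Q, g p ≤ 1 / 2) {H : ℕ} (hH : ∑ p ∈ Q, 2 * g p ≤ H) :
    1 ≤ 4 ^ H * ∏ p ∈ Q, (1 - g p) := by
  have h := prod_one_add_le_four_pow (g := fun p => 2 * g p)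
    (fun p hp => by linarith [h0 p hp]) hH
  have hpos : ∀ p ∈ Q, 0 < 1 - g p := fun p hp => by linarith [h1 p hp]
  calc (1 : ℝ) ≤ (∏ p ∈ Q, (1 + 2 * g p)) * ∏ p ∈ Q, (1 - g p) := by
        rw [← prod_mul_distrib]
        exact one_le_prod fun p hp => by nlinarith [h0 p hp, h1 p hp]
    _ ≤ _ := mul_le_mul_of_nonneg_right h (prod_nonneg fun p hp => (hpos p hp).le)

open Classical in
/-- The `y < Y` whose class modulo `p` avoids `Ω p` for every `p ∈ P`. -/
noncomputable def sifted (Ω : (p : ℕ) → Set (ZMod p)) (P : Finset ℕ) (Y : ℕ) : Finset ℕ :=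
  (range Y).filter fun y => ∀ p ∈ P, (y : ZMod p) ∉ Ω p

lemma mem_sifted {Ω : (p : ℕ) → Set (ZMod p)} {P : Finset ℕ} {Y y : ℕ} :
    y ∈ sifted Ω P Y ↔ y < Y ∧ ∀ p ∈ P, (y : ZMod p) ∉ Ω p := by
  simp [sifted]

/-- The expected proportion of integers surviving a sieve by `N` classes modulo each `p ∈ P`. -/
noncomputable def sieveDensity (N : ℕ) (P : Finset ℕ) : ℝ := ∏ p ∈ P, (1 - N / p : ℝ)

/-- Sifting by any `N` classes modulo each `p ∈ P` leaves the expected number of integers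
below `Y`, up to a relative error `η`, as soon as `Y₀ ≤ Y`. -/
def SievesWithin (N : ℕ) (P : Finset ℕ) (Y₀ : ℕ) (η : ℝ) : Prop :=
  ∀ Ω : (p : ℕ) → Set (ZMod p), (∀ p ∈ P, (Ω p).ncard = N) → ∀ Y : ℕ, Y₀ ≤ Y →
    |(#(sifted Ω P Y) : ℝ) - Y * sieveDensity N P| ≤ η * (Y * sieveDensity N P)

lemma sieveDensity_nonneg {N : ℕ} {P : Finset ℕ} (hP : ∀ p ∈ P, N ≤ p) :
    0 ≤ sieveDensity N P := by
  refine prod_nonneg fun p hp => sub_nonneg.2 (div_le_one_of_le₀ ?_ (by positivity))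
  exact_mod_cast hP p hp

open Classical in
lemma card_sifted_progression (Ω : (p : ℕ) → Set (ZMod p)) (P : Finset ℕ) (Y : ℕ) {c d : ℕ}
    (hc : c < d) :
    #((sifted Ω P Y).filter fun y => y % d = c) =
      #(sifted (fun p => (fun k : ZMod p => (c : ZMod p) + d * k) ⁻¹' Ω p) P
        ((Y + (d - 1 - c)) / d)) := by
  have hd : 0 < d := by omega
  symm
  apply card_nbij (fun k => c + d * k)
  · intro k hk
    rw [mem_coe, mem_sifted, Nat.lt_div_iff_mul_lt hd] at hk
    rw [mem_coe, mem_filter, mem_sifted]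
    refine ⟨⟨?_, ?_⟩, ?_⟩
    · have := hk.1
      rw [mul_comm] at this
      change c + d * k < Y
      omega
    · intro p hp
      have := hk.2 p hp
      simpa using this
    · rw [Nat.add_mul_mod_self_left, Nat.mod_eq_of_lt hc]
  · intro k _ k' _ h
    simpa [hd.ne'] using h
  · intro y hy
    simp only [coe_filter, Set.mem_ofPred_eq, mem_sifted] at hy
    obtain ⟨⟨hy1, hy2⟩, hy3⟩ := hy
    have hy4 := Nat.mod_add_div y d
    rw [hy3] at hy4
    refine ⟨y / d, ?_, hy4⟩
    rw [mem_coe, mem_sifted, Nat.lt_div_iff_mul_lt hd]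
    refine ⟨by rw [mul_comm]; omega, fun p hp => ?_⟩
    have := hy2 p hp
    rw [← hy4] at this
    simpa using this

lemma ncard_preimage_affine {p c d : ℕ} (hd : d.Coprime p) (S : Set (ZMod p)) :
    ((fun k : ZMod p => (c : ZMod p) + d * k) ⁻¹' S).ncard = S.ncard := by
  have hu : IsUnit (d : ZMod p) := (ZMod.isUnit_iff_coprime d p).2 hd
  apply Set.ncard_preimage_of_injective_subset_range
  · intro k k' h
    exact hu.mul_left_cancel (add_left_cancel h)
  · intro x _
    obtain ⟨e, he⟩ := hu.exists_right_inv
    exact ⟨e * (x - c), by linear_combination (x - c) * he⟩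

open Classical in
lemma SievesWithin.progression {N : ℕ} {P : Finset ℕ} {Y₀ : ℕ} {η : ℝ}
    (h : SievesWithin N P Y₀ η) (h1 : η ≤ 1) (hP : ∀ p ∈ P, N ≤ p)
    {Ω : (p : ℕ) → Set (ZMod p)} (hΩ : ∀ p ∈ P, (Ω p).ncard = N) {c d : ℕ} (hc : c < d)
    (hd : ∀ p ∈ P, d.Coprime p) {Y : ℕ} (hY : d * (Y₀ + 1) ≤ Y) (hdY : (d : ℝ) ≤ η * Y) :
    |(#((sifted Ω P Y).filter fun y => y % d = c) : ℝ) - Y / d * sieveDensity N P| ≤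
      3 * η * (Y / d * sieveDensity N P) := by
  have hd0 : 0 < d := by omega
  have hd0' : (0 : ℝ) < d := by exact_mod_cast hd0
  have hV := sieveDensity_nonneg hP
  rw [card_sifted_progression Ω P Y hc]
  set K := (Y + (d - 1 - c)) / d with hK
  have hK1 : d * K ≤ Y + (d - 1 - c) := Nat.mul_div_le _ _
  have hK2 : Y + (d - 1 - c) < d * K + d := Nat.lt_mul_div_succ _ hd0
  have hK0 : Y₀ ≤ K := by
    rw [hK, Nat.le_div_iff_mul_le hd0]
    nlinarith
  have hK3 : |(K : ℝ) - Y / d| ≤ 1 := by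
    have e1 : (d : ℝ) * K ≤ Y + d := by exact_mod_cast (by omega : d * K ≤ Y + d)
    have e2 : (Y : ℝ) ≤ d * K + d := by exact_mod_cast (by omega : Y ≤ d * K + d)
    rw [abs_le]
    constructor
    · have : (Y : ℝ) / d ≤ K + 1 := by rw [div_le_iff₀ hd0']; linarith
      linarith
    · have : (K : ℝ) - 1 ≤ Y / d := by rw [le_div_iff₀ hd0']; linarith
      linarith
  have key := h (fun p => (fun k : ZMod p => (c : ZMod p) + d * k) ⁻¹' Ω p)
    (fun p hp => by rw [ncard_preimage_affine (hd p hp), hΩ p hp]) K hK0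
  set V := sieveDensity N P
  set S : ℝ := (#(sifted (fun p => (fun k : ZMod p => (c : ZMod p) + d * k) ⁻¹' Ω p) P K) : ℝ)
  have hη : 1 ≤ η * (Y / d) := by
    rw [← mul_div_assoc, le_div_iff₀ hd0', one_mul]
    exact hdY
  have hYd : (0 : ℝ) ≤ Y / d := by positivity
  have hη0 : 0 ≤ η := by
    by_contra hneg
    nlinarith
  rw [abs_le] at key hK3 ⊢
  have a1 : (K : ℝ) * V ≤ Y / d * V + V := by nlinarith
  have a2 : (Y : ℝ) / d * V - V ≤ K * V := by nlinarith
  have a3 : V ≤ η * (Y / d * V) := by nlinarith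
  have a4 : η * (K * V) ≤ η * (Y / d * V) + V := by nlinarith
  constructor <;> nlinarith

open Classical in
lemma card_filter_cast_mem (p : ℕ) [NeZero p] (S : Set (ZMod p)) :
    #((range p).filter fun c : ℕ => (c : ZMod p) ∈ S) = S.ncard := by
  rw [← Set.ncard_coe_finset]
  apply Set.ncard_congr (fun (c : ℕ) _ => (c : ZMod p))
  · intro c hc
    simpa using (mem_filter.1 (mem_coe.1 hc)).2
  · intro a b ha hb hab
    have ha' := mem_range.1 (mem_filter.1 (mem_coe.1 ha)).1
    have hb' := mem_range.1 (mem_filter.1 (mem_coe.1 hb)).1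
    rw [ZMod.natCast_eq_natCast_iff', Nat.mod_eq_of_lt ha', Nat.mod_eq_of_lt hb'] at hab
    exact hab
  · intro x hx
    exact ⟨x.val, by simp [ZMod.val_lt, hx], by simp⟩

open Classical in
lemma card_filter_forall_cast_mem {N : ℕ} {s : Finset ℕ} (hs : ∀ p ∈ s, p.Prime)
    {Ω : (p : ℕ) → Set (ZMod p)} (hΩ : ∀ p ∈ s, (Ω p).ncard = N) :
    #((range (∏ p ∈ s, p)).filter fun c : ℕ => ∀ p ∈ s, (c : ZMod p) ∈ Ω p) = N ^ #s := by
  induction s using Finset.induction_on with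
  | empty => simp
  | insert q s hq ih =>
    have hqp := hs q (mem_insert_self _ _)
    have hs' : ∀ p ∈ s, p.Prime := fun p hp => hs p (mem_insert_of_mem hp)
    have := hqp.ne_zero
    have : NeZero q := ⟨hqp.ne_zero⟩
    have ih' := ih hs' fun p hp => hΩ p (mem_insert_of_mem hp)
    have h1 := card_filter_cast_mem q (Ω q)
    rw [hΩ q (mem_insert_self _ _)] at h1
    set d := ∏ p ∈ s, p with hd
    have hd0 : 0 < d := prod_pos fun p hp => (hs' p hp).pos
    have hcop : q.Coprime d := Nat.Coprime.prod_right fun p hp =>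
      (Nat.coprime_primes hqp (hs' p hp)).2 fun h => hq (h ▸ hp)
    have hmodq : ∀ c : ℕ, ((c % q : ℕ) : ZMod q) = c := fun c => by simp
    have hmodd : ∀ c : ℕ, ∀ p ∈ s, ((c % d : ℕ) : ZMod p) = c := fun c p hp => by
      rw [ZMod.natCast_eq_natCast_iff]
      exact (Nat.mod_modEq c d).of_dvd (dvd_prod_of_mem _ hp)
    rw [card_insert_of_notMem hq, pow_succ, mul_comm, ← ih', ← h1, ← card_product]
    rw [prod_insert hq, ← hd]
    apply card_nbij (fun c => (c % q, c % d))
    · intro c hc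
      have hc' := (mem_filter.1 (mem_coe.1 hc)).2
      simp only [mem_coe]
      simp only [mem_product, mem_filter, mem_range]
      refine ⟨⟨Nat.mod_lt _ hqp.pos, ?_⟩, Nat.mod_lt _ hd0, fun p hp => ?_⟩
      · rw [hmodq]
        exact hc' q (mem_insert_self _ _)
      · rw [hmodd c p hp]
        exact hc' p (mem_insert_of_mem hp)
    · intro a ha b hb hab
      have ha' := mem_range.1 (mem_filter.1 (mem_coe.1 ha)).1
      have hb' := mem_range.1 (mem_filter.1 (mem_coe.1 hb)).1
      simp only [Prod.mk.injEq] at hab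
      have : a ≡ b [MOD q * d] :=
        (Nat.modEq_and_modEq_iff_modEq_mul hcop).1 ⟨hab.1, hab.2⟩
      exact Nat.ModEq.eq_of_lt_of_lt this ha' hb'
    · rintro ⟨a, b⟩ hab
      simp only [coe_product, coe_filter, mem_range, Set.mem_prod, Set.mem_ofPred_eq] at hab
      obtain ⟨⟨ha, ha'⟩, hb, hb'⟩ := hab
      obtain ⟨k, hk1, hk2⟩ := Nat.chineseRemainder hcop a b
      have e1 : k % (q * d) % q = a := by
        rw [Nat.mod_mul_right_mod, hk1, Nat.mod_eq_of_lt ha]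
      have e2 : k % (q * d) % d = b := by
        rw [Nat.mod_mul_left_mod, hk2, Nat.mod_eq_of_lt hb]
      refine ⟨k % (q * d), ?_, by simp only [e1, e2]⟩
      simp only [coe_filter, mem_range, Set.mem_ofPred_eq]
      refine ⟨Nat.mod_lt _ (Nat.mul_pos hqp.pos hd0), fun p hp => ?_⟩
      rcases mem_insert.1 hp with rfl | hp
      · rw [← hmodq, e1]
        exact ha'
      · rw [← hmodd _ p hp, e2]
        exact hb' p hp

open Classical in
lemma SievesWithin.card_filter_forall_mem {N : ℕ} {P : Finset ℕ} {Y₀ : ℕ} {η : ℝ}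
    (h : SievesWithin N P Y₀ η) (h1 : η ≤ 1) (hP : ∀ p ∈ P, p.Prime) (hPN : ∀ p ∈ P, N ≤ p)
    {s : Finset ℕ} (hs : ∀ p ∈ s, p.Prime) (hPs : Disjoint P s)
    {Ω : (p : ℕ) → Set (ZMod p)} (hΩ : ∀ p ∈ P, (Ω p).ncard = N)
    (hΩs : ∀ p ∈ s, (Ω p).ncard = N) {Y : ℕ} (hY : (∏ p ∈ s, p) * (Y₀ + 1) ≤ Y)
    (hdY : ((∏ p ∈ s, p : ℕ) : ℝ) ≤ η * Y) :
    |(#((sifted Ω P Y).filter fun y => ∀ p ∈ s, (y : ZMod p) ∈ Ω p) : ℝ) -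
      Y * sieveDensity N P * ∏ p ∈ s, (N / p : ℝ)| ≤
      3 * η * (Y * sieveDensity N P) * ∏ p ∈ s, (N / p : ℝ) := by
  set d := ∏ p ∈ s, p with hd
  have hd0 : 0 < d := prod_pos fun p hp => (hs p hp).pos
  set C := (range d).filter fun c : ℕ => ∀ p ∈ s, (c : ZMod p) ∈ Ω p with hC
  have hCcard : #C = N ^ #s := card_filter_forall_cast_mem hs hΩs
  have hcop : ∀ p ∈ P, d.Coprime p := fun p hp => Nat.Coprime.prod_left fun q hq =>
    (Nat.coprime_primes (hs q hq) (hP p hp)).2 fun e =>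
      Finset.disjoint_left.1 hPs hp (e ▸ hq)
  have hmodd : ∀ c : ℕ, ∀ p ∈ s, ((c % d : ℕ) : ZMod p) = c := fun c p hp => by
    rw [ZMod.natCast_eq_natCast_iff]
    exact (Nat.mod_modEq c d).of_dvd (dvd_prod_of_mem _ hp)
  have hcount : #((sifted Ω P Y).filter fun y => ∀ p ∈ s, (y : ZMod p) ∈ Ω p) =
      ∑ c ∈ C, #((sifted Ω P Y).filter fun y => y % d = c) := by
    rw [card_eq_sum_card_fiberwise (f := fun y => y % d) (t := C)]
    · refine sum_congr rfl fun c hc => ?_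
      congr 1
      ext y
      simp only [mem_filter]
      constructor
      · rintro ⟨⟨h1, _⟩, h3⟩
        exact ⟨h1, h3⟩
      · rintro ⟨h1, rfl⟩
        exact ⟨⟨h1, fun p hp => hmodd y p hp ▸ (mem_filter.1 hc).2 p hp⟩, rfl⟩
    · intro y hy
      have hy' := (mem_filter.1 (mem_coe.1 hy)).2
      rw [mem_coe, mem_filter, mem_range]
      exact ⟨Nat.mod_lt _ hd0, fun p hp => by rw [hmodd y p hp]; exact hy' p hp⟩
  have hprod : ∏ p ∈ s, (N / p : ℝ) = #C / d := by
    rw [prod_div_distrib, prod_const, hCcard, hd]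
    push_cast
    rfl
  rw [hcount, hprod]
  push_cast
  have e1 : (Y : ℝ) * sieveDensity N P * (#C / d) = ∑ c ∈ C, Y / d * sieveDensity N P := by
    rw [sum_const, nsmul_eq_mul]
    ring
  have e2 : 3 * η * (Y * sieveDensity N P) * (#C / d) =
      ∑ c ∈ C, 3 * η * (Y / d * sieveDensity N P) := by
    rw [sum_const, nsmul_eq_mul]
    ring
  rw [e1, e2, ← sum_sub_distrib]
  refine (abs_sum_le_sum_abs _ _).trans (sum_le_sum fun c hc => ?_)
  exact h.progression h1 hPN hΩ (mem_range.1 (mem_filter.1 hc).1) hcop hY hdY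

open Classical in
lemma elemSum_indicator (Ω : (p : ℕ) → Set (ZMod p)) (Q : Finset ℕ) (A : Finset ℕ) (k : ℕ) :
    ∑ y ∈ A, elemSum Q k (fun p => if (y : ZMod p) ∈ Ω p then 1 else 0) =
      ∑ s ∈ Q.powersetCard k, (#(A.filter fun y => ∀ p ∈ s, (y : ZMod p) ∈ Ω p) : ℝ) := by
  unfold elemSum
  rw [sum_comm]
  refine sum_congr rfl fun s _ => ?_
  rw [card_filter]
  push_cast
  refine sum_congr rfl fun y _ => ?_
  rw [prod_ite_zero]
  simp

open Classical in
lemma sum_prod_indicator (Ω : (p : ℕ) → Set (ZMod p)) (P Q : Finset ℕ) (Y : ℕ) :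
    ∑ y ∈ sifted Ω P Y, ∏ p ∈ Q, (1 - (if (y : ZMod p) ∈ Ω p then 1 else 0) : ℝ) =
      #(sifted Ω (P ∪ Q) Y) := by
  have h : sifted Ω (P ∪ Q) Y = (sifted Ω P Y).filter fun y => ∀ p ∈ Q, (y : ZMod p) ∉ Ω p := by
    ext y
    simp only [mem_filter, mem_sifted, mem_union]
    grind
  rw [h, card_filter]
  push_cast
  refine sum_congr rfl fun y _ => ?_
  have : ∀ p, (1 - (if (y : ZMod p) ∈ Ω p then 1 else 0) : ℝ) =
      if (y : ZMod p) ∉ Ω p then 1 else 0 := fun p => by split_ifs <;> simp_all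
  simp_rw [this]
  rw [prod_ite_zero]
  simp

/-- Extending the range of a sieve by a further block of primes. -/
lemma SievesWithin.union {N : ℕ} {P Q : Finset ℕ} {Y₀ Y₁ Z m : ℕ} {η η' : ℝ}
    (h : SievesWithin N P Y₀ η) (h0 : 0 ≤ η) (h1 : η ≤ 1) (hP : ∀ p ∈ P, p.Prime)
    (hPN : ∀ p ∈ P, 2 * N ≤ p) (hQ : ∀ p ∈ Q, p.Prime) (hQN : ∀ p ∈ Q, 2 * N ≤ p)
    (hPQ : Disjoint P Q) (hZ : 1 ≤ Z) (hQZ : ∀ p ∈ Q, p ≤ Z)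
    (hsum : ∑ p ∈ Q, (1 / p : ℝ) ≤ 4) (hY₁ : Z ^ m * (Y₀ + 1) ≤ Y₁)
    (hYη : (Z : ℝ) ^ m ≤ η * Y₁)
    (hη' : 3 * η * 4 ^ (12 * N) + 5 * 4⁻¹ ^ m * 4 ^ (24 * N) ≤ η') :
    SievesWithin N (P ∪ Q) Y₁ η' := by
  classical
  intro Ω hΩ Y hY
  set g : ℕ → ℝ := fun p => N / p with hg
  have hg0 : ∀ p ∈ Q, 0 ≤ g p := fun p _ => by positivity
  have hg2 : ∀ p ∈ Q, g p ≤ 1 / 2 := fun p hp => by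
    have hp0 : (0 : ℝ) < p := by exact_mod_cast (hQ p hp).pos
    have : (2 : ℝ) * N ≤ p := by exact_mod_cast hQN p hp
    rw [hg, div_le_div_iff₀ hp0 (by norm_num)]
    linarith
  have hgsum : ∑ p ∈ Q, g p ≤ 4 * N := by
    have : ∑ p ∈ Q, g p = N * ∑ p ∈ Q, (1 / p : ℝ) := by
      rw [mul_sum]
      exact sum_congr rfl fun p _ => by simp [hg]; ring
    rw [this]
    nlinarith [Nat.cast_nonneg (α := ℝ) N]
  have hVQ : 1 ≤ 4 ^ (8 * N) * sieveDensity N Q :=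
    one_le_four_pow_mul_prod hg0 hg2 (by rw [← mul_sum]; push_cast; linarith)
  have hprod1 : ∏ p ∈ Q, (1 + g p) ≤ 4 ^ (4 * N) :=
    prod_one_add_le_four_pow hg0 (by push_cast; linarith)
  have hE : elemSum Q m g ≤ 4⁻¹ ^ m * 4 ^ (16 * N) :=
    (elemSum_le hg0 (by norm_num) m).trans (mul_le_mul_of_nonneg_left
      (prod_one_add_le_four_pow (fun p hp => by linarith [hg0 p hp])
        (by rw [← mul_sum]; push_cast; linarith)) (by positivity))
  have hVP : 0 ≤ sieveDensity N P := sieveDensity_nonneg fun p hp => by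
    have := hPN p hp
    omega
  have hVQ0 : 0 ≤ sieveDensity N Q := sieveDensity_nonneg fun p hp => by
    have := hQN p hp
    omega
  have hVPQ : sieveDensity N (P ∪ Q) = sieveDensity N P * sieveDensity N Q :=
    prod_union hPQ
  set T : ℝ := Y * sieveDensity N P with hT
  have hT0 : 0 ≤ T := by positivity
  set C : Finset ℕ → ℝ := fun s =>
    (#((sifted Ω P Y).filter fun y => ∀ p ∈ s, (y : ZMod p) ∈ Ω p) : ℝ) with hC
  have hCs : ∀ k ≤ m, ∀ s ∈ Q.powersetCard k,
      |C s - T * ∏ p ∈ s, g p| ≤ 3 * η * T * ∏ p ∈ s, g p := by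
    intro k hk s hs
    obtain ⟨hsQ, hsk⟩ := mem_powersetCard.1 hs
    have hd : ∏ p ∈ s, p ≤ Z ^ m := by
      calc ∏ p ∈ s, p ≤ Z ^ #s := prod_le_pow_card _ _ _ fun p hp => hQZ p (hsQ hp)
        _ ≤ Z ^ m := Nat.pow_le_pow_right hZ (by omega)
    refine h.card_filter_forall_mem h1 hP (fun p hp => ?_) (fun p hp => hQ p (hsQ hp))
      (disjoint_of_subset_right hsQ hPQ) (fun p hp => hΩ p (mem_union_left _ hp))
      (fun p hp => hΩ p (mem_union_right _ (hsQ hp))) ?_ ?_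
    · have := hPN p hp
      omega
    · calc _ ≤ Z ^ m * (Y₀ + 1) := by gcongr
        _ ≤ Y := hY₁.trans hY
    · calc ((∏ p ∈ s, p : ℕ) : ℝ) ≤ (Z : ℝ) ^ m := by exact_mod_cast hd
        _ ≤ η * Y₁ := hYη
        _ ≤ η * Y := by gcongr
  have hsumC : ∀ k ≤ m, |∑ s ∈ Q.powersetCard k, C s - T * elemSum Q k g| ≤
      3 * η * T * elemSum Q k g := by
    intro k hk
    unfold elemSum
    rw [mul_sum, mul_sum, ← sum_sub_distrib]
    exact (abs_sum_le_sum_abs _ _).trans (sum_le_sum fun s hs => hCs k hk s hs)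
  have hB1 : |(#(sifted Ω (P ∪ Q) Y) : ℝ) -
      ∑ k ∈ range m, (-1) ^ k * ∑ s ∈ Q.powersetCard k, C s| ≤
      ∑ s ∈ Q.powersetCard m, C s := by
    rw [← sum_prod_indicator]
    simp_rw [hC, ← elemSum_indicator, mul_sum]
    rw [sum_comm, ← sum_sub_distrib]
    refine (abs_sum_le_sum_abs _ _).trans (sum_le_sum fun y _ => ?_)
    apply abs_prod_one_sub_sub_le
    · intro p _
      split_ifs <;> norm_num
    · intro p _
      split_ifs <;> norm_num
  have hB2 : |∑ k ∈ range m, (-1) ^ k * ∑ s ∈ Q.powersetCard k, C s -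
      T * ∑ k ∈ range m, (-1) ^ k * elemSum Q k g| ≤ 3 * η * T * 4 ^ (4 * N) := by
    rw [mul_sum, ← sum_sub_distrib]
    calc _ ≤ ∑ k ∈ range m, 3 * η * T * elemSum Q k g := by
          refine (abs_sum_le_sum_abs _ _).trans (sum_le_sum fun k hk => ?_)
          have : (-1 : ℝ) ^ k * ∑ s ∈ Q.powersetCard k, C s - T * ((-1) ^ k * elemSum Q k g) =
              (-1) ^ k * (∑ s ∈ Q.powersetCard k, C s - T * elemSum Q k g) := by ring
          rw [this, abs_mul, abs_pow, abs_neg, abs_one, one_pow, one_mul]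
          exact hsumC k (mem_range.1 hk).le
      _ ≤ _ := by
          rw [← mul_sum]
          exact mul_le_mul_of_nonneg_left ((sum_elemSum_le hg0 m).trans hprod1) (by positivity)
  have hB3 : |T * sieveDensity N Q - T * ∑ k ∈ range m, (-1) ^ k * elemSum Q k g| ≤
      T * elemSum Q m g := by
    rw [← mul_sub, abs_mul, abs_of_nonneg hT0]
    exact mul_le_mul_of_nonneg_left
      (abs_prod_one_sub_sub_le hg0 (fun p hp => by linarith [hg2 p hp]) m) hT0
  have hB4 : ∑ s ∈ Q.powersetCard m, C s ≤ T * elemSum Q m g + 3 * η * (T * elemSum Q m g) := by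
    have := (abs_le.1 (hsumC m le_rfl)).2
    linarith
  have hE0 : 0 ≤ T * elemSum Q m g := mul_nonneg hT0 (elemSum_nonneg hg0 m)
  have hB5 : η * (T * elemSum Q m g) ≤ T * elemSum Q m g := mul_le_of_le_one_left hE0 h1
  have hB6 : T * elemSum Q m g ≤ T * (4⁻¹ ^ m * 4 ^ (16 * N)) :=
    mul_le_mul_of_nonneg_left hE hT0
  have hmain : |(#(sifted Ω (P ∪ Q) Y) : ℝ) - T * sieveDensity N Q| ≤
      T * (3 * η * 4 ^ (4 * N) + 5 * (4⁻¹ ^ m * 4 ^ (16 * N))) := by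
    rw [abs_le] at *
    constructor <;> linarith
  have hrw : (Y : ℝ) * sieveDensity N (P ∪ Q) = T * sieveDensity N Q := by
    rw [hVPQ, hT]
    ring
  rw [hrw]
  refine hmain.trans ?_
  calc T * (3 * η * 4 ^ (4 * N) + 5 * (4⁻¹ ^ m * 4 ^ (16 * N)))
      ≤ T * (3 * η * 4 ^ (4 * N) + 5 * (4⁻¹ ^ m * 4 ^ (16 * N))) *
          (4 ^ (8 * N) * sieveDensity N Q) :=
        le_mul_of_one_le_right (by positivity) hVQ
    _ = (3 * η * 4 ^ (12 * N) + 5 * 4⁻¹ ^ m * 4 ^ (24 * N)) * (T * sieveDensity N Q) := by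
        rw [show 12 * N = 4 * N + 8 * N by ring, show 24 * N = 16 * N + 8 * N by ring,
          pow_add, pow_add]
        ring
    _ ≤ η' * (T * sieveDensity N Q) := by gcongr

/-- A fundamental lemma for the sieve by `N` classes modulo each prime between `w` and `z`,
where `w = 2 ^ k` and `z = 2 ^ (k * 2 ^ j)`, with an adjustable relative error. -/
lemma sievesWithin_primesBetween_aux {N k : ℕ} (hN : 0 < N) (hk : 0 < k) (hNk : 2 * N ≤ 2 ^ k)
    (j i : ℕ) :
    SievesWithin N (primesBetween (2 ^ k) (2 ^ (k * 2 ^ j))) (2 ^ (k * 2 ^ j * (56 * N * (i + 2))))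
      (1 / 2 * 4⁻¹ ^ (14 * N * i)) := by
  induction j generalizing i with
  | zero =>
    intro Ω hΩ Y hY
    have h0 : primesBetween (2 ^ k) (2 ^ (k * 2 ^ 0)) = ∅ := by simp [primesBetween]
    have h1 : sifted Ω ∅ Y = range Y := by
      ext y
      simp [mem_sifted]
    rw [h0, h1]
    simp [sieveDensity]
  | succ j ih =>
    have hE : 0 < k * 2 ^ j := by positivity
    have hj : k * 2 ^ (j + 1) = 2 * (k * 2 ^ j) := by ring
    rw [hj]
    set E := k * 2 ^ j with hEdef
    have hkE : k ≤ E := Nat.le_mul_of_pos_right _ (by positivity)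
    rw [primesBetween_union (b := 2 ^ E) (Nat.pow_le_pow_right (by norm_num) hkE)
      (Nat.pow_le_pow_right (by norm_num) (by omega))]
    have hbig : ∀ a b p, 2 ^ k ≤ 2 ^ a → p ∈ primesBetween (2 ^ a) (2 ^ b) → 2 * N ≤ p := by
      intro a b p ha hp
      have := (mem_primesBetween.1 hp).1.1
      omega
    refine (ih (i + 1)).union (Z := 2 ^ (2 * E)) (m := 27 * N * (i + 1)) (by positivity)
      ?_ (fun p hp => (mem_primesBetween.1 hp).2) (fun p hp => hbig _ _ p le_rfl hp)
      (fun p hp => (mem_primesBetween.1 hp).2)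
      (fun p hp => hbig _ _ p (Nat.pow_le_pow_right (by norm_num) hkE) hp)
      (disjoint_primesBetween _ _ _) Nat.one_le_two_pow
      (fun p hp => (mem_primesBetween.1 hp).1.2) (sum_inv_primesBetween_sq hE) ?_ ?_ ?_
    · have : (4⁻¹ : ℝ) ^ (14 * N * (i + 1)) ≤ 1 := pow_le_one₀ (by norm_num) (by norm_num)
      linarith
    · calc (2 ^ (2 * E)) ^ (27 * N * (i + 1)) * (2 ^ (E * (56 * N * (i + 1 + 2))) + 1)
          ≤ (2 ^ (2 * E)) ^ (27 * N * (i + 1)) *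
              (2 ^ (E * (56 * N * (i + 1 + 2))) + 2 ^ (E * (56 * N * (i + 1 + 2)))) := by
            gcongr
            exact Nat.one_le_two_pow
        _ = 2 ^ (2 * E * (27 * N * (i + 1)) + (E * (56 * N * (i + 1 + 2)) + 1)) := by
            rw [← mul_two, ← pow_succ, ← pow_mul, ← pow_add]
        _ ≤ 2 ^ (2 * E * (56 * N * (i + 2))) := by
            apply Nat.pow_le_pow_right (by norm_num)
            have : 0 < E * N := by positivity
            nlinarith
    · have e1 : 1 / 2 * (4⁻¹ : ℝ) ^ (14 * N * (i + 1)) = (2 ^ (28 * N * (i + 1) + 1))⁻¹ := by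
        rw [show 28 * N * (i + 1) = 2 * (14 * N * (i + 1)) by ring]
        generalize 14 * N * (i + 1) = a
        rw [pow_succ, pow_mul, inv_pow]
        norm_num
      rw [e1, ← div_eq_inv_mul, le_div_iff₀ (by positivity)]
      push_cast
      rw [← pow_mul, ← pow_add]
      apply pow_le_pow_right₀ (by norm_num)
      have h1 : 1 ≤ E * N := Nat.mul_pos hE hN
      have h2 : N ≤ E * N := Nat.le_mul_of_pos_left _ hE
      nlinarith
    · have e1 : 14 * N * (i + 1) = 12 * N + (2 * N + 14 * N * i) := by ring
      have e2 : 27 * N * (i + 1) = 24 * N + (3 * N + (14 * N * i + 13 * N * i)) := by ring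
      have e3 : ∀ a : ℕ, (4⁻¹ : ℝ) ^ a * 4 ^ a = 1 := fun a => by
        rw [← mul_pow]
        norm_num
      have e4 : ∀ a b : ℕ, b ≤ a → (4⁻¹ : ℝ) ^ a ≤ 4⁻¹ ^ b := fun a b hab =>
        pow_le_pow_of_le_one (by norm_num) (by norm_num) hab
      have f1 : (4⁻¹ : ℝ) ^ (2 * N) ≤ 1 / 16 := (e4 (2 * N) 2 (by omega)).trans (by norm_num)
      have f2 : (4⁻¹ : ℝ) ^ (3 * N) ≤ 1 / 64 := (e4 (3 * N) 3 (by omega)).trans (by norm_num)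
      have f3 : (4⁻¹ : ℝ) ^ (13 * N * i) ≤ 1 := pow_le_one₀ (by norm_num) (by norm_num)
      set x : ℝ := 4⁻¹ ^ (14 * N * i) with hx
      have hx0 : 0 < x := by positivity
      rw [e1, e2]
      calc _ = 3 / 2 * (4⁻¹ ^ (2 * N) * x) * (4⁻¹ ^ (12 * N) * 4 ^ (12 * N)) +
            5 * (4⁻¹ ^ (3 * N) * (x * 4⁻¹ ^ (13 * N * i))) * (4⁻¹ ^ (24 * N) * 4 ^ (24 * N)) := by
            simp only [pow_add]
            ring
        _ ≤ 3 / 2 * (1 / 16 * x) * 1 + 5 * (1 / 64 * (x * 1)) * 1 := by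
            rw [e3, e3]
            gcongr
        _ ≤ 1 / 2 * x := by linarith

lemma sievesWithin_primesBetween {N k : ℕ} (hN : 0 < N) (hk : 0 < k) (hNk : 2 * N ≤ 2 ^ k)
    (j : ℕ) :
    SievesWithin N (primesBetween (2 ^ k) (2 ^ (k * 2 ^ j))) (2 ^ (k * 2 ^ j * (112 * N)))
      (1 / 2) := by
  have h := sievesWithin_primesBetween_aux hN hk hNk j 0
  rw [show 56 * N * (0 + 2) = 112 * N by ring] at h
  simpa using h

/-- Linear forms `u i + v i * y` whose values have no prime factor up to `2 ^ k` and which have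
`N` distinct roots modulo every larger prime. -/
structure AdmissibleForms (N k : ℕ) (u v : Fin N → ℕ) : Prop where
  one_lt : ∀ i, 1 < u i
  not_dvd_value : ∀ p : ℕ, p.Prime → p ≤ 2 ^ k → ∀ i y, ¬ p ∣ u i + v i * y
  not_dvd_coeff : ∀ p : ℕ, p.Prime → 2 ^ k < p → ∀ i, ¬ p ∣ v i
  not_dvd_det : ∀ p : ℕ, p.Prime → 2 ^ k < p → ∀ i j, i ≠ j →
    ¬ (p : ℤ) ∣ (u i : ℤ) * v j - (u j : ℤ) * v i

/-- The classes modulo `p` where one of the forms `u i + v i * y` vanishes. -/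
def formRoots {N : ℕ} (u v : Fin N → ℕ) (p : ℕ) : Set (ZMod p) :=
  {t | ∃ i, (u i : ZMod p) + v i * t = 0}

lemma AdmissibleForms.ncard_formRoots {N k : ℕ} {u v : Fin N → ℕ} (h : AdmissibleForms N k u v)
    {p : ℕ} (hp : p.Prime) (hkp : 2 ^ k < p) : (formRoots u v p).ncard = N := by
  have : Fact p.Prime := ⟨hp⟩
  have hv : ∀ i, (v i : ZMod p) ≠ 0 := fun i hi =>
    h.not_dvd_coeff p hp hkp i ((ZMod.natCast_eq_zero_iff _ _).1 hi)
  have hrange : formRoots u v p = Set.range fun i => -(u i : ZMod p) / v i := by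
    ext t
    constructor
    · rintro ⟨i, hi⟩
      refine ⟨i, ?_⟩
      rw [div_eq_iff (hv i)]
      linear_combination -hi
    · rintro ⟨i, rfl⟩
      refine ⟨i, ?_⟩
      have := hv i
      field_simp
      ring
  have hinj : Function.Injective fun i => -(u i : ZMod p) / v i := by
    intro i j hij
    by_contra hne
    apply h.not_dvd_det p hp hkp i j hne
    rw [← ZMod.intCast_zmod_eq_zero_iff_dvd]
    have hvi := hv i
    have hvj := hv j
    simp only at hij
    rw [div_eq_div_iff hvi hvj] at hij
    push_cast
    linear_combination -hij
  rw [hrange, ← Set.image_univ, Set.ncard_image_of_injective _ hinj, Set.ncard_univ]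
  simp

lemma AdmissibleForms.lt_of_dvd {N k E : ℕ} {u v : Fin N → ℕ} (h : AdmissibleForms N k u v)
    {Y y : ℕ} (hy : y ∈ sifted (formRoots u v) (primesBetween (2 ^ k) (2 ^ E)) Y) {p : ℕ}
    (hp : p.Prime) {i : Fin N} (hpi : p ∣ u i + v i * y) : 2 ^ E < p := by
  by_contra hE
  have hk : 2 ^ k < p := by
    by_contra hk
    exact h.not_dvd_value p hp (not_lt.1 hk) i y hpi
  refine (mem_sifted.1 hy).2 p (mem_primesBetween.2 ⟨⟨hk, not_lt.1 hE⟩, hp⟩) ⟨i, ?_⟩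
  rw [← ZMod.natCast_eq_zero_iff] at hpi
  exact_mod_cast hpi

lemma card_divisors_of_squarefree {n : ℕ} (hn : Squarefree n) :
    #n.divisors = 2 ^ #n.primeFactors := by
  rw [Nat.card_divisors hn.ne_zero, ← prod_const]
  refine prod_congr rfl fun p hp => ?_
  rw [Nat.factorization_eq_one_of_squarefree hn (Nat.prime_of_mem_primeFactors hp)
    (Nat.dvd_of_mem_primeFactors hp)]

lemma exists_ne_eq_of_sum_lt {N C : ℕ} {f : Fin N → ℕ} (hC : 4 * C ≤ N) (hf : ∑ i, f i < N * C) :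
    ∃ i j, i ≠ j ∧ f i = f j := by
  by_contra! hne
  have h1 : #(univ.filter fun i => f i < 2 * C) ≤ 2 * C := by
    calc _ ≤ #(range (2 * C)) := by
          refine card_le_card_of_injOn f (fun i hi => ?_) fun i _ j _ hij => ?_
          · have := (mem_filter.1 (mem_coe.1 hi)).2
            simpa using this
          · by_contra h
            exact hne i j h hij
      _ = _ := card_range _
  have h2 : #(univ.filter fun i => ¬ f i < 2 * C) * (2 * C) ≤ ∑ i, f i := by
    calc _ = ∑ i ∈ univ.filter (fun i => ¬ f i < 2 * C), 2 * C := by rw [sum_const, smul_eq_mul]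
      _ ≤ ∑ i ∈ univ.filter (fun i => ¬ f i < 2 * C), f i :=
        sum_le_sum fun i hi => not_lt.1 (mem_filter.1 hi).2
      _ ≤ ∑ i, f i := sum_le_sum_of_subset (filter_subset _ _)
  have h3 := card_filter_add_card_filter_not (s := (univ : Finset (Fin N)))
    (fun i => f i < 2 * C)
  rw [card_univ, Fintype.card_fin] at h3
  nlinarith

lemma card_le_of_prod_dvd {Z n r : ℕ} {s : Finset ℕ} (hn : n ≠ 0) (hs : ∀ p ∈ s, p.Prime)
    (hZ : ∀ p ∈ s, Z ≤ p) (hdvd : ∀ p ∈ s, p ∣ n) (hnZ : n < Z ^ (r + 1)) (hZ0 : 0 < Z) :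
    #s ≤ r := by
  by_contra! hr
  have h1 : ∏ p ∈ s, p ∣ n :=
    Finset.prod_primes_dvd n (fun p hp => (hs p hp).prime) hdvd
  have h2 : Z ^ #s ≤ ∏ p ∈ s, p := pow_card_le_prod _ _ _ hZ
  have h3 : Z ^ (r + 1) ≤ Z ^ #s := Nat.pow_le_pow_right hZ0 hr
  have := Nat.le_of_dvd (Nat.pos_of_ne_zero hn) h1
  omega

lemma sum_inv_sq_Ioc_le {A B : ℕ} (hA : 0 < A) :
    ∑ p ∈ Ioc A B, (1 / (p : ℝ) ^ 2) ≤ 1 / (A : ℝ) := by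
  rcases le_total A B with hAB | hAB
  · have h := sum_Ioc_inv_sq_le_sub (α := ℝ) hA.ne' hAB
    simp_rw [one_div]
    refine h.trans (sub_le_self _ (by positivity))
  · rw [Ioc_eq_empty_of_le hAB, sum_empty]
    positivity

lemma exists_lt_forall_dvd_iff {m u v : ℕ} (hm : 0 < m) (hv : v.Coprime m) :
    ∃ c < m, ∀ y, m ∣ u + v * y → y % m = c := by
  by_cases h : ∃ y, m ∣ u + v * y
  · obtain ⟨y₀, h₀⟩ := h
    refine ⟨y₀ % m, Nat.mod_lt _ hm, fun y hy => ?_⟩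
    have h1 : u + v * y ≡ u + v * y₀ [MOD m] :=
      ((Nat.modEq_zero_iff_dvd).2 hy).trans ((Nat.modEq_zero_iff_dvd).2 h₀).symm
    have h2 : v * y ≡ v * y₀ [MOD m] := Nat.ModEq.add_left_cancel' u h1
    exact Nat.ModEq.cancel_left_of_coprime hv.symm h2
  · push Not at h
    exact ⟨0, hm, fun y hy => (h y hy).elim⟩

open Classical in
lemma card_filter_dvd_le {m u v Y : ℕ} (hm : 0 < m) (hv : v.Coprime m) :
    (#((range Y).filter fun y => m ∣ u + v * y) : ℝ) ≤ Y / m + 1 := by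
  obtain ⟨c, _, hc⟩ := exists_lt_forall_dvd_iff (u := u) hm hv
  have h1 : #((range Y).filter fun y => m ∣ u + v * y) ≤ Y / m + 1 := by
    calc _ ≤ #(range (Y / m + 1)) := by
          refine card_le_card_of_injOn (fun y => y / m) (fun y hy => ?_) fun y hy y' hy' h => ?_
          · have := mem_range.1 (mem_filter.1 (mem_coe.1 hy)).1
            rw [mem_coe, mem_range, Nat.lt_succ_iff]
            exact Nat.div_le_div_right this.le
          · have h' : y / m = y' / m := h
            rw [← Nat.mod_add_div y m, ← Nat.mod_add_div y' m,
              hc y (mem_filter.1 (mem_coe.1 hy)).2, hc y' (mem_filter.1 (mem_coe.1 hy')).2, h']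
      _ = _ := card_range _
  calc (#((range Y).filter fun y => m ∣ u + v * y) : ℝ) ≤ ((Y / m + 1 : ℕ) : ℝ) := by
        exact_mod_cast h1
    _ ≤ Y / m + 1 := by
        push_cast
        gcongr
        exact Nat.cast_div_le

/-- The number of sifted `y < Y` for which a form is divisible by a given modulus without small
prime factors. -/
lemma AdmissibleForms.card_sifted_dvd_le {N k j : ℕ} {u v : Fin N → ℕ}
    (h : AdmissibleForms N k u v) (hN : 0 < N) (hk : 0 < k) (hNk : 2 * N ≤ 2 ^ k) (i : Fin N)
    {m : ℕ} (hm : m ≤ 2 ^ (k * 2 ^ j * (128 * N))) (hm0 : 0 < m)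
    (hmp : ∀ p, p.Prime → p ∣ m → 2 ^ (k * 2 ^ j) < p) :
    (#((sifted (formRoots u v) (primesBetween (2 ^ k) (2 ^ (k * 2 ^ j)))
      (2 ^ (k * 2 ^ j * (256 * N)))).filter fun y => m ∣ u i + v i * y) : ℝ) ≤
      5 / 2 * ((2 ^ (k * 2 ^ j * (256 * N)) : ℕ) *
        sieveDensity N (primesBetween (2 ^ k) (2 ^ (k * 2 ^ j)))) * (1 / m) := by
  classical
  have hE : 0 < k * 2 ^ j := by positivity
  have hs := sievesWithin_primesBetween hN hk hNk j
  have hkE : k ≤ k * 2 ^ j := Nat.le_mul_of_pos_right _ (by positivity)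
  set E := k * 2 ^ j with hEdef
  set Y := 2 ^ (E * (256 * N)) with hYdef
  have hEN : 1 ≤ E * N := Nat.mul_pos hE hN
  have hkE' : 2 ^ k ≤ 2 ^ E := Nat.pow_le_pow_right (by norm_num) hkE
  have hvm : (v i).Coprime m := Nat.Coprime.symm <| Nat.coprime_of_dvd fun p hp hpm hpv =>
    h.not_dvd_coeff p hp (hkE'.trans_lt (hmp p hp hpm)) i hpv
  obtain ⟨c, hc, hcy⟩ := exists_lt_forall_dvd_iff (u := u i) hm0 hvm
  have hprog := hs.progression (by norm_num)
    (fun p hp => by have := (mem_primesBetween.1 hp).1.1; omega)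
    (Ω := formRoots u v)
    (fun p hp => h.ncard_formRoots (mem_primesBetween.1 hp).2 (mem_primesBetween.1 hp).1.1)
    hc (fun p hp => by
      rw [Nat.coprime_comm, (mem_primesBetween.1 hp).2.coprime_iff_not_dvd]
      intro hpm
      have := hmp p (mem_primesBetween.1 hp).2 hpm
      have := (mem_primesBetween.1 hp).1.2
      omega) (Y := Y) (by
      calc m * (2 ^ (E * (112 * N)) + 1) ≤ 2 ^ (E * (128 * N)) *
            (2 ^ (E * (112 * N)) + 2 ^ (E * (112 * N))) := by
            gcongr
            exact Nat.one_le_two_pow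
        _ = 2 ^ (E * (128 * N) + (E * (112 * N) + 1)) := by
            rw [← mul_two, ← pow_succ, ← pow_add]
        _ ≤ Y := Nat.pow_le_pow_right (by norm_num) (by nlinarith)) (by
      have : 2 * m ≤ Y := by
        calc 2 * m ≤ 2 * 2 ^ (E * (128 * N)) := by gcongr
          _ = 2 ^ (E * (128 * N) + 1) := by rw [pow_succ, mul_comm]
          _ ≤ Y := Nat.pow_le_pow_right (by norm_num) (by nlinarith)
      have : (2 : ℝ) * m ≤ Y := by exact_mod_cast this
      linarith)
  have hle : #((sifted (formRoots u v) (primesBetween (2 ^ k) (2 ^ E)) Y).filter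
      fun y => m ∣ u i + v i * y) ≤ #((sifted (formRoots u v) (primesBetween (2 ^ k) (2 ^ E))
      Y).filter fun y => y % m = c) :=
    card_le_card fun y hy => by
      rw [mem_filter] at hy ⊢
      exact ⟨hy.1, hcy y hy.2⟩
  have h1 := (abs_le.1 hprog).2
  calc _ ≤ (#((sifted (formRoots u v) (primesBetween (2 ^ k) (2 ^ E)) Y).filter
      fun y => y % m = c) : ℝ) := by exact_mod_cast hle
    _ ≤ _ := by
      rw [show 5 / 2 * ((Y : ℕ) * sieveDensity N (primesBetween (2 ^ k) (2 ^ E))) * (1 / (m : ℝ)) =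
        5 / 2 * (Y / m * sieveDensity N (primesBetween (2 ^ k) (2 ^ E))) by ring]
      linarith

/-- The arguments `y < 2 ^ (256 * N * E)` for which the forms `u i + v i * y` have no prime factor
between `2 ^ k` and `2 ^ E`. -/
noncomputable def roughArgs {N : ℕ} (k E : ℕ) (u v : Fin N → ℕ) : Finset ℕ :=
  sifted (formRoots u v) (primesBetween (2 ^ k) (2 ^ E)) (2 ^ (E * (256 * N)))

namespace AdmissibleForms

variable {N k j : ℕ} {u v : Fin N → ℕ}

lemma mul_sieveDensity_le (h : AdmissibleForms N k u v) (hN : 0 < N) (hk : 0 < k)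
    (hNk : 2 * N ≤ 2 ^ k) :
    (2 ^ (k * 2 ^ j * (256 * N)) : ℕ) * sieveDensity N (primesBetween (2 ^ k) (2 ^ (k * 2 ^ j))) ≤
      2 * #(roughArgs k (k * 2 ^ j) u v) := by
  have hs := sievesWithin_primesBetween hN hk hNk j (formRoots u v)
    (fun p hp => h.ncard_formRoots (mem_primesBetween.1 hp).2 (mem_primesBetween.1 hp).1.1)
    (2 ^ (k * 2 ^ j * (256 * N))) (Nat.pow_le_pow_right (by norm_num) (by gcongr; norm_num))
  have := (abs_le.1 hs).1
  rw [roughArgs]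
  linarith

lemma one_le_mul_sieveDensity (hk : 0 < k) (hNk : 2 * N ≤ 2 ^ k) :
    1 ≤ (2 : ℝ) ^ (k * 2 ^ j * (16 * N)) *
      sieveDensity N (primesBetween (2 ^ k) (2 ^ (k * 2 ^ j))) := by
  have hN : ∀ p ∈ primesBetween (2 ^ k) (2 ^ (k * 2 ^ j)), 2 * N ≤ p := fun p hp =>
    hNk.trans (mem_primesBetween.1 hp).1.1.le
  have h1 : 1 ≤ 4 ^ (8 * N * j) *
      sieveDensity N (primesBetween (2 ^ k) (2 ^ (k * 2 ^ j))) := by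
    refine one_le_four_pow_mul_prod (fun p _ => by positivity) (fun p hp => ?_) ?_
    · have hp0 : (0 : ℝ) < p := by exact_mod_cast (mem_primesBetween.1 hp).2.pos
      have : (2 : ℝ) * N ≤ p := by exact_mod_cast hN p hp
      rw [div_le_div_iff₀ hp0 two_pos]
      linarith
    · calc ∑ p ∈ primesBetween (2 ^ k) (2 ^ (k * 2 ^ j)), 2 * (N / p : ℝ) =
            2 * N * ∑ p ∈ primesBetween (2 ^ k) (2 ^ (k * 2 ^ j)), (1 / p : ℝ) := by
            rw [mul_sum]
            exact sum_congr rfl fun p _ => by ring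
        _ ≤ 2 * N * (4 * j) := by
            gcongr
            exact sum_inv_primesBetween_iterate hk j
        _ = _ := by
            push_cast
            ring
  refine h1.trans ?_
  gcongr
  · exact sieveDensity_nonneg fun p hp => by have := hN p hp; omega
  · rw [show (4 : ℝ) = 2 ^ 2 by norm_num, ← pow_mul]
    refine pow_le_pow_right₀ one_le_two ?_
    have h2 : j ≤ k * 2 ^ j := j.lt_two_pow_self.le.trans (Nat.le_mul_of_pos_left _ hk)
    calc 2 * (8 * N * j) = j * (16 * N) := by ring
      _ ≤ _ := by gcongr

lemma two_pow_le_mul_card (h : AdmissibleForms N k u v) (hN : 0 < N) (hk : 0 < k)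
    (hNk : 2 * N ≤ 2 ^ k) :
    (2 : ℝ) ^ (k * 2 ^ j * (240 * N)) ≤ 2 * #(roughArgs k (k * 2 ^ j) u v) := by
  have h1 := one_le_mul_sieveDensity (N := N) (j := j) hk hNk
  refine le_trans ?_ (h.mul_sieveDensity_le (j := j) hN hk hNk)
  calc (2 : ℝ) ^ (k * 2 ^ j * (240 * N)) = 2 ^ (k * 2 ^ j * (240 * N)) * 1 := by ring
    _ ≤ 2 ^ (k * 2 ^ j * (240 * N)) * ((2 : ℝ) ^ (k * 2 ^ j * (16 * N)) *
      sieveDensity N (primesBetween (2 ^ k) (2 ^ (k * 2 ^ j)))) := by gcongr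
    _ = _ := by
      rw [← mul_assoc, ← pow_add]
      push_cast
      ring_nf

lemma card_roughArgs_dvd_le (h : AdmissibleForms N k u v) (hN : 0 < N) (hk : 0 < k)
    (hNk : 2 * N ≤ 2 ^ k) (i : Fin N) {m : ℕ} (hm : m ≤ 2 ^ (k * 2 ^ j * (128 * N))) (hm0 : 0 < m)
    (hmp : ∀ p : ℕ, p.Prime → p ∣ m → 2 ^ (k * 2 ^ j) < p) :
    (#((roughArgs k (k * 2 ^ j) u v).filter fun y => m ∣ u i + v i * y) : ℝ) ≤
      5 * #(roughArgs k (k * 2 ^ j) u v) * (1 / m) := by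
  refine (h.card_sifted_dvd_le hN hk hNk i hm hm0 hmp).trans ?_
  have := h.mul_sieveDensity_le (j := j) hN hk hNk
  exact mul_le_mul_of_nonneg_right (by linarith) (by positivity)

/-- On average, the forms have few prime factors of moderate size. -/
lemma sum_card_primeFactors_le (h : AdmissibleForms N k u v) (hN : 0 < N) (hk : 0 < k)
    (hNk : 2 * N ≤ 2 ^ k) {s : ℕ} (hs : 128 * N = 2 ^ s) :
    ∑ y ∈ roughArgs k (k * 2 ^ j) u v, ∑ i,
      #((primesBetween (2 ^ (k * 2 ^ j)) (2 ^ (k * 2 ^ j * (128 * N)))).filter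
        fun p => p ∣ u i + v i * y) ≤ 20 * N * s * #(roughArgs k (k * 2 ^ j) u v) := by
  have hE : 0 < k * 2 ^ j := by positivity
  set E := k * 2 ^ j with hEdef
  set S := roughArgs k E u v
  set Q := primesBetween (2 ^ E) (2 ^ (E * (128 * N)))
  have key : ∑ y ∈ S, ∑ i, #(Q.filter fun p => p ∣ u i + v i * y) =
      ∑ i, ∑ p ∈ Q, #(S.filter fun y => p ∣ u i + v i * y) := by
    rw [sum_comm]
    refine sum_congr rfl fun i _ => ?_
    simp_rw [card_filter]
    rw [sum_comm]
  have hQ : ∀ i, ∑ p ∈ Q, (#(S.filter fun y => p ∣ u i + v i * y) : ℝ) ≤ 20 * s * #S := fun i =>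
    calc _ ≤ ∑ p ∈ Q, 5 * #S * (1 / p : ℝ) := by
          refine sum_le_sum fun p hp => ?_
          obtain ⟨⟨hp1, hp2⟩, hp⟩ := mem_primesBetween.1 hp
          refine h.card_roughArgs_dvd_le hN hk hNk i hp2 hp.pos fun q hq hqp => ?_
          rwa [(Nat.prime_dvd_prime_iff_eq hq hp).1 hqp]
      _ = 5 * #S * ∑ p ∈ Q, (1 / p : ℝ) := by rw [mul_sum]
      _ ≤ 5 * #S * (4 * s) := by
          gcongr
          have := sum_inv_primesBetween_iterate hE s
          rwa [← hs] at this
      _ = _ := by ring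
  rw [key]
  have : (∑ i, ∑ p ∈ Q, (#(S.filter fun y => p ∣ u i + v i * y) : ℝ)) ≤ 20 * N * s * #S :=
    calc _ ≤ ∑ i : Fin N, (20 * s * #S : ℝ) := sum_le_sum fun i _ => hQ i
      _ = _ := by
        rw [sum_const, card_univ, Fintype.card_fin, nsmul_eq_mul]
        ring
  exact_mod_cast this

lemma value_le {E y : ℕ} {i : Fin N} (huv : u i + v i ≤ 2 ^ E) (hy : y < 2 ^ (E * (256 * N))) :
    u i + v i * y ≤ 2 ^ (E * (256 * N + 1)) := by
  calc u i + v i * y ≤ u i * 2 ^ (E * (256 * N)) + v i * 2 ^ (E * (256 * N)) := by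
        gcongr
        exact Nat.le_mul_of_pos_right _ (by positivity)
    _ = (u i + v i) * 2 ^ (E * (256 * N)) := by ring
    _ ≤ 2 ^ E * 2 ^ (E * (256 * N)) := by gcongr
    _ = _ := by rw [← pow_add]; ring_nf

lemma exists_sq_dvd {E y : ℕ} (h : AdmissibleForms N k u v) {i : Fin N}
    (hy : y ∈ roughArgs k E u v) (huv : u i + v i ≤ 2 ^ E) (hsq : ¬ Squarefree (u i + v i * y)) :
    ∃ p ∈ primesBetween (2 ^ E) (2 ^ (E * (128 * N + 1))), p ^ 2 ∣ u i + v i * y := by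
  rw [Nat.squarefree_iff_prime_squarefree] at hsq
  push Not at hsq
  obtain ⟨p, hp, hpd⟩ := hsq
  rw [← sq] at hpd
  refine ⟨p, mem_primesBetween.2 ⟨⟨h.lt_of_dvd hy hp ((dvd_pow_self p two_ne_zero).trans hpd),
    ?_⟩, hp⟩, hpd⟩
  have hpos : 0 < u i + v i * y := by have := h.one_lt i; omega
  refine (Nat.pow_le_pow_iff_left two_ne_zero).1 ((Nat.le_of_dvd hpos hpd).trans
    ((value_le huv (mem_sifted.1 hy).1).trans ?_))
  rw [← pow_mul]
  exact Nat.pow_le_pow_right two_pos (by nlinarith)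

lemma sum_inv_sq_primesBetween_le {A B : ℕ} (hA : 0 < A) :
    ∑ p ∈ primesBetween A B, (1 / (p : ℝ) ^ 2) ≤ 1 / (A : ℝ) :=
  (sum_le_sum_of_subset_of_nonneg (filter_subset _ _) fun _ _ _ => by positivity).trans
    (sum_inv_sq_Ioc_le hA)

/-- Few values of the forms are divisible by the square of a prime. -/
lemma sum_card_sq_dvd_le (h : AdmissibleForms N k u v) (hN : 0 < N) (hk : 0 < k)
    (hNk : 2 * N ≤ 2 ^ k) (i : Fin N) :
    ∑ p ∈ primesBetween (2 ^ (k * 2 ^ j)) (2 ^ (k * 2 ^ j * (128 * N + 1))),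
      (#((roughArgs k (k * 2 ^ j) u v).filter fun y => p ^ 2 ∣ u i + v i * y) : ℝ) ≤
      7 * #(roughArgs k (k * 2 ^ j) u v) * (1 / 2 ^ (k * 2 ^ j)) := by
  have hE : 0 < k * 2 ^ j := by positivity
  have hkE : k ≤ k * 2 ^ j := Nat.le_mul_of_pos_right _ (by positivity)
  have hcard := h.two_pow_le_mul_card (j := j) hN hk hNk
  set E := k * 2 ^ j with hEdef
  set S := roughArgs k E u v
  have hEN : E ≤ E * N := Nat.le_mul_of_pos_right _ hN
  rw [primesBetween_union (b := 2 ^ (E * (64 * N)))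
    (Nat.pow_le_pow_right two_pos (by nlinarith)) (Nat.pow_le_pow_right two_pos (by nlinarith)),
    sum_union (disjoint_primesBetween _ _ _)]
  have h1 : ∑ p ∈ primesBetween (2 ^ E) (2 ^ (E * (64 * N))),
      (#(S.filter fun y => p ^ 2 ∣ u i + v i * y) : ℝ) ≤ 5 * #S * (1 / 2 ^ E) :=
    calc _ ≤ ∑ p ∈ primesBetween (2 ^ E) (2 ^ (E * (64 * N))), (5 : ℝ) * #S * (1 / (p : ℝ) ^ 2) := by
          refine sum_le_sum fun p hp => ?_
          obtain ⟨⟨hp1, hp2⟩, hp⟩ := mem_primesBetween.1 hp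
          have := h.card_roughArgs_dvd_le (j := j) hN hk hNk i (m := p ^ 2) (by
            calc p ^ 2 ≤ (2 ^ (E * (64 * N))) ^ 2 := by gcongr
              _ = 2 ^ (E * (128 * N)) := by rw [← pow_mul]; ring_nf) (pow_pos hp.pos 2) fun q hq hqp => by
            rwa [(Nat.prime_dvd_prime_iff_eq hq hp).1 (hq.dvd_of_dvd_pow hqp)]
          push_cast at this
          exact this
      _ = (5 : ℝ) * #S * ∑ p ∈ primesBetween (2 ^ E) (2 ^ (E * (64 * N))), (1 / (p : ℝ) ^ 2) := by
          rw [mul_sum]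
      _ ≤ 5 * #S * (1 / 2 ^ E) := by
          gcongr
          have := sum_inv_sq_primesBetween_le (A := 2 ^ E) (B := 2 ^ (E * (64 * N))) (by positivity)
          push_cast at this
          exact this
  have h2 : ∑ p ∈ primesBetween (2 ^ (E * (64 * N))) (2 ^ (E * (128 * N + 1))),
      (#(S.filter fun y => p ^ 2 ∣ u i + v i * y) : ℝ) ≤ 2 * 2 ^ (E * (192 * N)) :=
    calc _ ≤ ∑ p ∈ primesBetween (2 ^ (E * (64 * N))) (2 ^ (E * (128 * N + 1))),
          ((2 : ℝ) ^ (E * (256 * N)) * (1 / (p : ℝ) ^ 2) + 1) := by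
          refine sum_le_sum fun p hp => ?_
          obtain ⟨⟨hp1, -⟩, hp⟩ := mem_primesBetween.1 hp
          have hkp : 2 ^ k < p := lt_of_le_of_lt
            (Nat.pow_le_pow_right two_pos (by nlinarith)) hp1
          have h3 := card_filter_dvd_le (u := u i) (v := v i) (Y := 2 ^ (E * (256 * N)))
            (pow_pos hp.pos 2) (Nat.Coprime.pow_right 2 (Nat.coprime_comm.1
              ((hp.coprime_iff_not_dvd).2 (h.not_dvd_coeff p hp hkp i))))
          have h4 : #(S.filter fun y => p ^ 2 ∣ u i + v i * y) ≤
              #((range (2 ^ (E * (256 * N)))).filter fun y => p ^ 2 ∣ u i + v i * y) :=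
            card_le_card (filter_subset_filter _ fun y hy => mem_range.2 (mem_sifted.1 hy).1)
          have h5 : (#(S.filter fun y => p ^ 2 ∣ u i + v i * y) : ℝ) ≤
              #((range (2 ^ (E * (256 * N)))).filter fun y => p ^ 2 ∣ u i + v i * y) := by
            exact_mod_cast h4
          refine h5.trans ?_
          push_cast at h3
          rw [mul_one_div]
          convert h3
      _ = (2 : ℝ) ^ (E * (256 * N)) * ∑ p ∈ primesBetween (2 ^ (E * (64 * N)))
            (2 ^ (E * (128 * N + 1))), (1 / (p : ℝ) ^ 2) +
            #(primesBetween (2 ^ (E * (64 * N))) (2 ^ (E * (128 * N + 1)))) := by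
          rw [sum_add_distrib, mul_sum, sum_const, nsmul_one]
      _ ≤ (2 : ℝ) ^ (E * (256 * N)) * (1 / 2 ^ (E * (64 * N))) + 2 ^ (E * (128 * N + 1)) := by
          gcongr
          · have := sum_inv_sq_primesBetween_le (A := 2 ^ (E * (64 * N)))
              (B := 2 ^ (E * (128 * N + 1))) (by positivity)
            push_cast at this
            exact this
          · have : #(primesBetween (2 ^ (E * (64 * N))) (2 ^ (E * (128 * N + 1)))) ≤
                2 ^ (E * (128 * N + 1)) := by
              refine (card_filter_le _ _).trans ?_
              rw [Nat.card_Ioc]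
              exact Nat.sub_le _ _
            exact_mod_cast this
      _ ≤ 2 ^ (E * (192 * N)) + 2 ^ (E * (192 * N)) := by
          gcongr ?_ + ?_
          · rw [mul_one_div, div_le_iff₀ (by positivity), ← pow_add]
            exact le_of_eq (by ring_nf)
          · exact pow_le_pow_right₀ one_le_two (by nlinarith)
      _ = _ := by ring
  have h3 : 2 * (2 : ℝ) ^ (E * (192 * N)) ≤ 2 * #S * (1 / 2 ^ E) := by
    rw [mul_one_div, le_div_iff₀ (by positivity)]
    refine le_trans ?_ hcard
    calc 2 * (2 : ℝ) ^ (E * (192 * N)) * 2 ^ E = 2 ^ (1 + E * (192 * N) + E) := by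
          rw [pow_add, pow_add, pow_one]
      _ ≤ _ := pow_le_pow_right₀ one_le_two (by nlinarith)
  linarith

open Classical in
lemma card_not_squarefree_le (h : AdmissibleForms N k u v) (hN : 0 < N) (hk : 0 < k)
    (hNk : 2 * N ≤ 2 ^ k) (hNE : 40 * N ≤ 2 ^ (k * 2 ^ j))
    (huv : ∀ i, u i + v i ≤ 2 ^ (k * 2 ^ j)) :
    4 * #((roughArgs k (k * 2 ^ j) u v).filter fun y => ¬ ∀ i, Squarefree (u i + v i * y)) ≤
      #(roughArgs k (k * 2 ^ j) u v) := by
  have hsum := h.sum_card_sq_dvd_le (j := j) hN hk hNk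
  set E := k * 2 ^ j with hEdef
  set S := roughArgs k E u v
  set Q := primesBetween (2 ^ E) (2 ^ (E * (128 * N + 1)))
  have hsub : (S.filter fun y => ¬ ∀ i, Squarefree (u i + v i * y)) ⊆
      univ.biUnion fun i => Q.biUnion fun p => S.filter fun y => p ^ 2 ∣ u i + v i * y := by
    intro y hy
    obtain ⟨hyS, hy⟩ := mem_filter.1 hy
    push Not at hy
    obtain ⟨i, hi⟩ := hy
    obtain ⟨p, hp, hpd⟩ := h.exists_sq_dvd hyS (huv i) hi
    exact mem_biUnion.2 ⟨i, mem_univ i, mem_biUnion.2 ⟨p, hp, mem_filter.2 ⟨hyS, hpd⟩⟩⟩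
  have hle : #(S.filter fun y => ¬ ∀ i, Squarefree (u i + v i * y)) ≤
      ∑ i, ∑ p ∈ Q, #(S.filter fun y => p ^ 2 ∣ u i + v i * y) :=
    (card_le_card hsub).trans (card_biUnion_le.trans (sum_le_sum fun i _ => card_biUnion_le))
  have hle' : (#(S.filter fun y => ¬ ∀ i, Squarefree (u i + v i * y)) : ℝ) ≤
      ∑ i, ∑ p ∈ Q, (#(S.filter fun y => p ^ 2 ∣ u i + v i * y) : ℝ) := by
    exact_mod_cast hle
  have hNE' : (40 : ℝ) * N ≤ 2 ^ E := by exact_mod_cast hNE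
  have : (∑ i, ∑ p ∈ Q, (#(S.filter fun y => p ^ 2 ∣ u i + v i * y) : ℝ)) ≤ 1 / 4 * #S :=
    calc _ ≤ ∑ i : Fin N, (7 * #S * (1 / 2 ^ E) : ℝ) := sum_le_sum fun i _ => hsum i
      _ = 7 * #S * (N / 2 ^ E) := by
        rw [sum_const, card_univ, Fintype.card_fin, nsmul_eq_mul]
        ring
      _ ≤ 7 * #S * (1 / 40) := by
        refine mul_le_mul_of_nonneg_left ?_ (by positivity)
        rw [div_le_div_iff₀ (by positivity) (by norm_num)]
        linarith
      _ ≤ 1 / 4 * #S := by linarith [Nat.cast_nonneg (α := ℝ) #S]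
  have : (4 : ℝ) * #(S.filter fun y => ¬ ∀ i, Squarefree (u i + v i * y)) ≤ #S := by linarith
  exact_mod_cast this

lemma exists_squarefree (h : AdmissibleForms N k u v) (hN : 0 < N) (hk : 0 < k)
    (hNk : 2 * N ≤ 2 ^ k) (hNE : 40 * N ≤ 2 ^ (k * 2 ^ j))
    (huv : ∀ i, u i + v i ≤ 2 ^ (k * 2 ^ j)) {s : ℕ} (hs0 : 0 < s) (hs : 128 * N = 2 ^ s) :
    ∃ y ∈ roughArgs k (k * 2 ^ j) u v, (∀ i, Squarefree (u i + v i * y)) ∧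
      ∑ i, #((primesBetween (2 ^ (k * 2 ^ j)) (2 ^ (k * 2 ^ j * (128 * N)))).filter
        fun p => p ∣ u i + v i * y) < 40 * N * s := by
  classical
  by_contra! hcon
  have hsum := h.sum_card_primeFactors_le (j := j) hN hk hNk hs
  have hbad := h.card_not_squarefree_le (j := j) hN hk hNk hNE huv
  have hcard := h.two_pow_le_mul_card (j := j) hN hk hNk
  set S := roughArgs k (k * 2 ^ j) u v
  have hS : 0 < #S := by
    have : (0 : ℝ) < 2 * #S := lt_of_lt_of_le (by positivity) hcard
    have : (0 : ℝ) < #S := by linarith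
    exact_mod_cast this
  have h1 : #(S.filter fun y => ∀ i, Squarefree (u i + v i * y)) * (40 * N * s) ≤
      20 * N * s * #S := by
    refine le_trans ?_ hsum
    rw [← smul_eq_mul, ← sum_const]
    refine (sum_le_sum fun y hy => ?_).trans (sum_le_sum_of_subset (filter_subset _ _))
    exact hcon y (mem_filter.1 hy).1 (mem_filter.1 hy).2
  have h2 := card_filter_add_card_filter_not (s := S)
    (fun y => ∀ i, Squarefree (u i + v i * y))
  have h3 : 2 * #(S.filter fun y => ∀ i, Squarefree (u i + v i * y)) ≤ #S := by
    refine Nat.le_of_mul_le_mul_left (c := 20 * N * s) ?_ (by positivity)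
    linarith
  omega

/-- Among sufficiently many admissible linear forms, two take large values with the same number of
divisors. -/
theorem exists_card_divisors_eq (h : AdmissibleForms N k u v) (hN : 0 < N) (hk : 0 < k)
    (hNk : 2 * N ≤ 2 ^ k) {s : ℕ} (hs0 : 0 < s) (hs : 128 * N = 2 ^ s)
    (hsN : 4 * (40 * s + 2) ≤ N) (X : ℕ) :
    ∃ y i j, i ≠ j ∧ (∀ i, X < u i + v i * y) ∧
      #(u i + v i * y).divisors = #(u j + v j * y).divisors := by
  set J := 40 * N + X + ∑ i, (u i + v i)
  have hJ : J ≤ 2 ^ (k * 2 ^ J) := by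
    have h1 : J ≤ k * 2 ^ J := J.lt_two_pow_self.le.trans (Nat.le_mul_of_pos_left _ hk)
    exact h1.trans (k * 2 ^ J).lt_two_pow_self.le
  have huv : ∀ i, u i + v i ≤ 2 ^ (k * 2 ^ J) := fun i => by
    have := single_le_sum (f := fun i => u i + v i) (fun _ _ => Nat.zero_le _) (mem_univ i)
    have h2 : u i + v i ≤ ∑ i, (u i + v i) := this
    omega
  have hE : 0 < k * 2 ^ J := by positivity
  obtain ⟨y, hy, hsq, hmid⟩ := h.exists_squarefree (j := J) hN hk hNk (by omega) huv hs0 hs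
  set E := k * 2 ^ J
  have hpos : ∀ i, 1 < u i + v i * y := fun i => by have := h.one_lt i; omega
  have hω : ∀ i, #(u i + v i * y).primeFactors ≤
      #((primesBetween (2 ^ E) (2 ^ (E * (128 * N)))).filter fun p => p ∣ u i + v i * y) + 2 := by
    intro i
    rw [← card_filter_add_card_filter_not (s := (u i + v i * y).primeFactors)
      (fun p => p ≤ 2 ^ (E * (128 * N)))]
    refine add_le_add (card_le_card fun p hp => ?_) ?_
    · obtain ⟨hp, hpE⟩ := mem_filter.1 hp
      have hpp := Nat.prime_of_mem_primeFactors hp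
      have hpd := Nat.dvd_of_mem_primeFactors hp
      exact mem_filter.2 ⟨mem_primesBetween.2 ⟨⟨h.lt_of_dvd hy hpp hpd, hpE⟩, hpp⟩, hpd⟩
    · refine card_le_of_prod_dvd (Z := 2 ^ (E * (128 * N))) (n := u i + v i * y)
        (by have := hpos i; omega)
        (fun p hp => Nat.prime_of_mem_primeFactors (mem_filter.1 hp).1)
        (fun p hp => (not_le.1 (mem_filter.1 hp).2).le)
        (fun p hp => Nat.dvd_of_mem_primeFactors (mem_filter.1 hp).1) ?_ (by positivity)
      refine (value_le (huv i) (mem_sifted.1 hy).1).trans_lt ?_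
      rw [← pow_mul]
      exact Nat.pow_lt_pow_right one_lt_two (by nlinarith [Nat.mul_pos hE hN])
  have hsum : ∑ i, #(u i + v i * y).primeFactors < N * (40 * s + 2) := by
    refine (sum_le_sum fun i _ => hω i).trans_lt ?_
    rw [sum_add_distrib, sum_const, card_univ, Fintype.card_fin, smul_eq_mul]
    linarith
  obtain ⟨i, j, hij, heq⟩ := exists_ne_eq_of_sum_lt hsN hsum
  refine ⟨y, i, j, hij, fun i => ?_, ?_⟩
  · obtain ⟨p, hp, hpd⟩ := Nat.exists_prime_and_dvd (hpos i).ne'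
    have h1 := h.lt_of_dvd hy hp hpd
    have h2 := Nat.le_of_dvd (by have := hpos i; omega) hpd
    omega
  · rw [card_divisors_of_squarefree (hsq i), card_divisors_of_squarefree (hsq j), heq]

end AdmissibleForms

lemma exists_forall_mul_modEq {N : ℕ} {c m : Fin N → ℕ} (b : Fin N → ℕ) (hm : ∀ i, m i ≠ 0)
    (hc : ∀ i, (c i).Coprime (m i)) (hcop : ∀ i j, i ≠ j → (m i).Coprime (m j)) :
    ∃ x, ∀ i, c i * x ≡ b i [MOD m i] := by
  have h1 : ∀ i, ∃ y, c i * y ≡ b i [MOD m i] := fun i => by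
    have : NeZero (m i) := ⟨hm i⟩
    refine ⟨((c i : ZMod (m i))⁻¹ * b i).val, ?_⟩
    rw [← ZMod.natCast_eq_natCast_iff]
    push_cast
    rw [ZMod.natCast_zmod_val, ← mul_assoc, ZMod.coe_mul_inv_eq_one _ (hc i), one_mul]
  choose y hy using h1
  obtain ⟨x, hx⟩ := Nat.chineseRemainderOfFinset y m univ (fun i _ => hm i)
    (fun i _ j _ hij => hcop i j hij)
  exact ⟨x, fun i => ((hx i (mem_univ i)).mul_left (c i)).trans (hy i)⟩

lemma exists_injective_prime_gt (N B : ℕ) :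
    ∃ q : Fin N → ℕ, Function.Injective q ∧ ∀ i, (q i).Prime ∧ B < q i := by
  refine ⟨fun i => Nat.nth Nat.Prime (B + 1 + i), fun i j hij => ?_, fun i =>
    ⟨Nat.prime_nth_prime _, ?_⟩⟩
  · have := Nat.nth_injective Nat.infinite_setOfPred_prime hij
    exact Fin.ext (by omega)
  · have : B + 1 + i ≤ Nat.nth Nat.Prime (B + 1 + i) :=
      (Nat.nth_strictMono Nat.infinite_setOfPred_prime).le_apply
    change B < Nat.nth Nat.Prime (B + 1 + i)
    omega

/-- Positive integers `a i` whose differences divide them, together with multipliers `t i`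
balancing the divisor counts of `n * a j / (a j - a i)` and `n * a i / (a j - a i)`. -/
structure BalancedTuple (n N : ℕ) (a t : Fin N → ℕ) : Prop where
  pos : ∀ i, 0 < a i
  mult_pos : ∀ i, 0 < t i
  injective : Function.Injective a
  sub_dvd : ∀ i j, a i < a j → a j - a i ∣ a i
  balanced : ∀ i j, a i < a j →
    t i * #(n * (a j / (a j - a i))).divisors = t j * #(n * (a i / (a j - a i))).divisors

namespace BalancedTuple

variable {n N : ℕ} {a t : Fin N → ℕ}

lemma const_mul (h : BalancedTuple n N a t) {c : ℕ} (hc : 0 < c) :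
    BalancedTuple n N a fun i => c * t i where
  pos := h.pos
  mult_pos i := Nat.mul_pos hc (h.mult_pos i)
  injective := h.injective
  sub_dvd := h.sub_dvd
  balanced i j hij := by rw [mul_assoc, mul_assoc, h.balanced i j hij]

lemma translate (h : BalancedTuple n N a t) {D : ℕ} {s : Fin N → ℕ}
    (hs : ∀ i, a i + D = a i * s i) (hcop : ∀ i, (s i).Coprime (n * a i)) :
    BalancedTuple n N (fun i => a i * s i) fun i => t i * #(s i).divisors where
  pos i := by rw [← hs]; have := h.pos i; omega
  mult_pos i := by
    refine Nat.mul_pos (h.mult_pos i) (card_pos.2 (Nat.nonempty_divisors.2 ?_))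
    intro h0
    have := hs i
    have := h.pos i
    rw [h0] at *
    omega
  injective i j hij := by
    refine h.injective ?_
    simp only [← hs] at hij
    omega
  sub_dvd i j hij := by
    simp only [← hs] at hij
    have hd := h.sub_dvd i j (by omega)
    rw [← hs, ← hs, Nat.add_sub_add_right, hs]
    exact hd.mul_right _
  balanced i j hij := by
    simp only [← hs] at hij
    replace hij : a i < a j := by omega
    have hd := h.sub_dvd i j hij
    have hd' : a j - a i ∣ a j := (Nat.dvd_sub_iff_left hij.le hd).1 dvd_rfl
    have hb := h.balanced i j hij
    have hdiff : a j * s j - a i * s i = a j - a i := by rw [← hs, ← hs, Nat.add_sub_add_right]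
    have hcard : ∀ l, a j - a i ∣ a l → #(n * (a l * s l / (a j - a i))).divisors =
        #(n * (a l / (a j - a i))).divisors * #(s l).divisors := fun l hl => by
      rw [Nat.mul_comm (a l), Nat.mul_div_assoc _ hl, mul_left_comm, mul_comm (s l),
        Nat.Coprime.card_divisors_mul]
      exact ((hcop l).coprime_dvd_right (mul_dvd_mul_left n (Nat.div_dvd_of_dvd hl))).symm
    rw [hdiff, hcard j hd', hcard i hd]
    linear_combination (#(s i).divisors * #(s j).divisors) * hb

lemma cons (h : BalancedTuple n N a t) (hn : 0 < n) {B W : ℕ} {b : Fin N → ℕ} (hB : 0 < B)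
    (hW : 0 < W) (hb : ∀ i, B = a i * b i) (hcop : ∀ i, (b i + 1).Coprime (n * a i))
    (hbW : ∀ i, t i * #(n * b i).divisors = W) :
    BalancedTuple n (N + 1) (Fin.cons B fun i => a i * (b i + 1))
      (Fin.cons W fun i => #n.divisors * (t i * #(b i + 1).divisors)) := by
  have hs : ∀ i, a i + B = a i * (b i + 1) := fun i => by rw [hb i]; ring
  have h' := (h.translate hs hcop).const_mul (c := #n.divisors)
    (card_pos.2 (Nat.nonempty_divisors.2 hn.ne'))
  refine ⟨Fin.cases hB h'.pos, Fin.cases hW h'.mult_pos, ?_, ?_, ?_⟩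
  · rw [Fin.cons_injective_iff]
    refine ⟨?_, h'.injective⟩
    rintro ⟨i, hi⟩
    have := hs i
    have := h.pos i
    simp only at hi
    omega
  · refine Fin.cases (Fin.cases (by simp) fun j hj => ?_) fun i => Fin.cases (fun hi => ?_)
      fun j => h'.sub_dvd i j
    · simp only [Fin.cons_zero, Fin.cons_succ] at hj ⊢
      rw [← hs, Nat.add_sub_cancel]
      exact ⟨_, hb j⟩
    · simp only [Fin.cons_zero, Fin.cons_succ, ← hs] at hi
      omega
  · refine Fin.cases (Fin.cases (by simp) fun j hj => ?_) fun i => Fin.cases (fun hi => ?_)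
      fun j => h'.balanced i j
    · simp only [Fin.cons_zero, Fin.cons_succ] at hj ⊢
      have hdiff : a j * (b j + 1) - B = a j := by rw [← hs, Nat.add_sub_cancel]
      rw [hdiff, Nat.mul_div_cancel_left _ (h.pos j)]
      have hdiv : B / a j = b j := by rw [hb j, Nat.mul_div_cancel_left _ (h.pos j)]
      rw [hdiv, Nat.Coprime.card_divisors_mul, ← hbW j]
      · ring
      · exact ((hcop j).coprime_dvd_right (dvd_mul_right _ _)).symm
    · simp only [Fin.cons_zero, Fin.cons_succ, ← hs] at hi
      omega

end BalancedTuple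

/-- Translating divisors of `A` by a common amount multiplies them by pairwise coprime numbers
with prescribed exponents at some prime. -/
lemma exists_translate_eq_mul_prime_pow {N A : ℕ} {a R : Fin N → ℕ} (hA : 0 < A)
    (haA : ∀ i, a i ∣ A) (hsub : ∀ i j, a i < a j → a j - a i ∣ A)
    (hinj : Function.Injective a) :
    ∃ (D : ℕ) (q m : Fin N → ℕ), (∀ i, (q i).Prime) ∧
      (∀ i, a i + D = a i * (q i ^ R i * m i)) ∧ (∀ i, ¬ q i ∣ m i) ∧
      (∀ i, A.Coprime (q i ^ R i * m i)) ∧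
      ∀ i j, i ≠ j → (q i ^ R i * m i).Coprime (q j ^ R j * m j) := by
  obtain ⟨q, hqinj, hq⟩ := exists_injective_prime_gt N A
  set c : Fin N → ℕ := fun i => A * (A / a i) with hc
  have hac : ∀ i, a i * c i = A * A := fun i => by
    rw [hc]
    simp only
    rw [mul_left_comm, Nat.mul_div_cancel' (haA i)]
  have hqA : ∀ i, A.Coprime (q i) := fun i => Nat.coprime_comm.1 <|
    (hq i).1.coprime_iff_not_dvd.2 fun hd => (Nat.le_of_dvd hA hd).not_gt (hq i).2
  obtain ⟨x, hx⟩ := exists_forall_mul_modEq (c := c) (m := fun i => q i ^ (R i + 1))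
    (fun i => q i ^ R i - 1) (fun i => pow_ne_zero _ (hq i).1.ne_zero)
    (fun i => Nat.Coprime.pow_right _ (Nat.Coprime.mul_left (hqA i)
      ((hqA i).coprime_dvd_left (Nat.div_dvd_of_dvd (haA i)))))
    (fun i j hij => Nat.Coprime.pow _ _
      ((Nat.coprime_primes (hq i).1 (hq j).1).2 fun h => hij (hqinj h)))
  have hmod : ∀ i, 1 + c i * x ≡ q i ^ R i [MOD q i ^ (R i + 1)] := fun i => by
    have h1 := (hx i).add_left 1
    have h2 : 1 ≤ q i ^ R i := Nat.one_le_pow _ _ (hq i).1.pos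
    rwa [Nat.add_sub_cancel' h2] at h1
  have hdvd : ∀ i, q i ^ R i ∣ 1 + c i * x := fun i =>
    ((hmod i).of_dvd (pow_dvd_pow _ (Nat.le_succ _))).dvd_iff dvd_rfl |>.2 dvd_rfl
  choose m hm using hdvd
  have hs : ∀ i, a i + A * A * x = a i * (q i ^ R i * m i) := fun i => by
    rw [← hm, ← hac i]
    ring
  have hcop : ∀ i, A.Coprime (q i ^ R i * m i) := fun i => by
    rw [← hm, hc]
    simp only
    rw [mul_assoc, Nat.coprime_add_mul_left_right]
    exact Nat.coprime_one_right _
  refine ⟨A * A * x, q, m, fun i => (hq i).1, hs, fun i hd => ?_, hcop, fun i j hij => ?_⟩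
  · have h1 : q i ^ (R i + 1) ∣ 1 + c i * x := by
      rw [hm, pow_succ]
      exact mul_dvd_mul_left _ hd
    have h2 := ((hmod i).dvd_iff dvd_rfl).1 h1
    have := (Nat.pow_dvd_pow_iff_le_right (hq i).1.one_lt).1 h2
    omega
  · wlog hlt : a i < a j generalizing i j
    · exact (this j i hij.symm (lt_of_le_of_ne (not_lt.1 hlt) fun h => hij (hinj h).symm)).symm
    refine Nat.coprime_of_dvd fun p hp hpi hpj => ?_
    have h1 : p ∣ a j - a i := by
      have h2 := Nat.dvd_sub (hs j ▸ hpj.mul_left (a j)) (hs i ▸ hpi.mul_left (a i))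
      rwa [Nat.add_sub_add_right] at h2
    exact hp.one_lt.ne' (Nat.dvd_one.1 ((hcop i).symm.gcd_eq_one ▸
      Nat.dvd_gcd hpi (h1.trans (hsub i j hlt))))

/-- Choice of a common multiple `B` of the numbers `a i * (q i ^ R i * m i)` with prescribed
divisor counts of the quotients `b i`, up to a constant factor. -/
lemma exists_common_multiple {n N A : ℕ} {a q m R : Fin N → ℕ} (hA : 0 < A) (hA2 : 2 ∣ A)
    (hnA : n ∣ A) (haA : ∀ i, a i ∣ A) (hR : ∀ i, 2 ≤ R i) (hq : ∀ i, (q i).Prime)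
    (hqm : ∀ i, ¬ q i ∣ m i) (hcop : ∀ i, A.Coprime (q i ^ R i * m i))
    (hpair : ∀ i j, i ≠ j → (q i ^ R i * m i).Coprime (q j ^ R j * m j)) :
    ∃ (b : Fin N → ℕ) (B W : ℕ), 0 < B ∧ 0 < W ∧ (∀ i, B = a i * (q i ^ R i * m i) * b i) ∧
      (∀ i, (b i + 1).Coprime (n * (a i * (q i ^ R i * m i)))) ∧
      ∀ i, #(q i ^ R i * m i).divisors * #(n * b i).divisors =
        #(n * (A * (A / a i))).divisors * R i * W := by
  set e : Fin N → ℕ := fun i => R i ^ 2 - 1 with he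
  have heR : ∀ i, e i + 1 = R i ^ 2 := fun i => by
    have : 1 ≤ R i ^ 2 := Nat.one_le_pow _ _ (by have := hR i; omega)
    simp only [he]
    omega
  have he0 : ∀ i, e i ≠ 0 := fun i h => by
    have := heR i
    have := hR i
    nlinarith
  set F : Fin N → ℕ := fun i => q i ^ (R i + e i) * m i with hF
  have hR0 : ∀ i, R i ≠ 0 := fun i => by have := hR i; omega
  have hm0 : ∀ i, m i ≠ 0 := fun i h => hqm i (h ▸ dvd_zero _)
  have hF0 : ∀ i, 0 < F i := fun i =>
    Nat.mul_pos (pow_pos (hq i).pos _) (Nat.pos_of_ne_zero (hm0 i))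
  have hFdvd : ∀ i, F i ∣ (q i ^ R i * m i) ^ (R i + e i) := fun i => by
    rw [mul_pow]
    refine mul_dvd_mul (pow_dvd_pow_of_dvd (dvd_pow_self _ (hR0 i)) _) (dvd_pow_self _ ?_)
    have := hR0 i
    omega
  have hFA : ∀ i, A.Coprime (F i) := fun i =>
    ((hcop i).pow_right _).coprime_dvd_right (hFdvd i)
  have hFF : ∀ i j, i ≠ j → (F i).Coprime (F j) := fun i j hij =>
    (((hpair i j hij).pow _ _).coprime_dvd_left (hFdvd i)).coprime_dvd_right (hFdvd j)
  have hqF : ∀ i, q i ∣ F i := fun i =>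
    (dvd_pow_self _ (by have := hR0 i; omega)).mul_right _
  have hmF : ∀ i, m i ∣ F i := fun i => dvd_mul_left _ _
  have hqmc : ∀ i, (q i).Coprime (m i) := fun i => (hq i).coprime_iff_not_dvd.2 (hqm i)
  set G : Fin N → ℕ := fun i => ∏ j ∈ univ.erase i, F j
  have hFG : ∀ i, F i * G i = ∏ j, F j := fun i => mul_prod_erase _ _ (mem_univ i)
  have hFGc : ∀ i, (F i).Coprime (G i) := fun i =>
    Nat.Coprime.prod_right fun j hj => hFF i j (ne_of_mem_erase hj).symm
  have hAG : ∀ i, A.Coprime (G i) := fun i => Nat.Coprime.prod_right fun j _ => hFA j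
  set c : Fin N → ℕ := fun i => A * (A / a i) * (q i ^ e i * G i) with hc
  have hAa : ∀ i, A / a i ∣ A := fun i => Nat.div_dvd_of_dvd (haA i)
  have hcm : ∀ i, (c i).Coprime (m i) := fun i => by
    have h1 := (hFA i).coprime_dvd_right (hmF i)
    exact (h1.mul_left (h1.coprime_dvd_left (hAa i))).mul_left
      (((hqmc i).pow_left _).mul_left ((hFGc i).symm.coprime_dvd_right (hmF i)))
  obtain ⟨r₀, hr₀⟩ := exists_forall_mul_modEq (c := c) (m := m) (fun _ => 1) hm0 hcm
    (fun i j hij => ((hFF i j hij).coprime_dvd_left (hmF i)).coprime_dvd_right (hmF j))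
  have hr₀m : r₀.Coprime (∏ i, m i) := Nat.Coprime.prod_right fun i _ => by
    have h1 : (c i * r₀).gcd (m i) = 1 := by rw [(hr₀ i).gcd_eq, Nat.gcd_one_left]
    exact Nat.Coprime.coprime_mul_left h1
  obtain ⟨r, hrgt, hr, hrmod⟩ := Nat.forall_exists_prime_gt_and_modEq (A * ∏ i, F i)
    (prod_ne_zero_iff.2 fun i _ => hm0 i) hr₀m
  have hprod0 : 0 < ∏ i, F i := prod_pos fun i _ => hF0 i
  have hrcop : ∀ x, x ∣ A * ∏ i, F i → x.Coprime r := fun x hx => by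
    rw [Nat.coprime_comm, hr.coprime_iff_not_dvd]
    exact fun hrx => (Nat.le_of_dvd (Nat.mul_pos hA hprod0) (hrx.trans hx)).not_gt hrgt
  have hGdvd : ∀ i, G i ∣ A * ∏ i, F i := fun i =>
    ((Dvd.intro_left _ (hFG i)).mul_left A)
  have hFdvd' : ∀ i, F i ∣ A * ∏ i, F i := fun i =>
    ((Dvd.intro _ (hFG i)).mul_left A)
  refine ⟨fun i => c i * r, A * A * (∏ i, F i) * r, #((∏ i, F i) * r).divisors,
    Nat.mul_pos (Nat.mul_pos (Nat.mul_pos hA hA) hprod0) hr.pos,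
    card_pos.2 (Nat.nonempty_divisors.2 (Nat.mul_pos hprod0 hr.pos).ne'), fun i => ?_,
    fun i => ?_, fun i => ?_⟩
  · rw [← hFG i, hF, hc]
    simp only
    nth_rewrite 1 [← Nat.mul_div_cancel' (haA i)]
    rw [pow_add]
    ring
  · have hcA : A ∣ c i * r := ((dvd_mul_right _ _).mul_right _).mul_right _
    have h1 : (c i * r + 1).Coprime A := by
      obtain ⟨x, hx⟩ := hcA
      rw [hx, add_comm, mul_comm, Nat.coprime_add_mul_right_left]
      exact Nat.coprime_one_left _
    have h2 : (c i * r + 1).Coprime (q i) := by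
      have hqc : q i ∣ c i * r := (((dvd_pow_self _ (he0 i)).mul_right _).mul_left _).mul_right _
      obtain ⟨x, hx⟩ := hqc
      rw [hx, add_comm, mul_comm, Nat.coprime_add_mul_right_left]
      exact Nat.coprime_one_left _
    have h3 : (c i * r + 1).Coprime (m i) := by
      have h4 : c i * r + 1 ≡ 2 [MOD m i] :=
        (((hrmod.of_dvd (dvd_prod_of_mem _ (mem_univ i))).mul_left (c i)).trans
          (hr₀ i)).add_right 1
      have h5 : (2 : ℕ).gcd (m i) = 1 := ((hFA i).coprime_dvd_right (hmF i)).coprime_dvd_left hA2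
      rw [Nat.Coprime, h4.gcd_eq, h5]
    exact (h1.coprime_dvd_right hnA).mul_right
      ((h1.coprime_dvd_right (haA i)).mul_right ((h2.pow_right _).mul_right h3))
  · have hqG : (q i).Coprime (G i) := (hFGc i).coprime_dvd_left (hqF i)
    have hqr : (q i).Coprime r := hrcop _ ((hqF i).trans (hFdvd' i))
    have hGr : (G i).Coprime r := hrcop _ (hGdvd i)
    have hAX : A.Coprime (q i ^ e i * (G i * r)) :=
      (((hFA i).coprime_dvd_right (hqF i)).pow_right _).mul_right
        ((hAG i).mul_right (hrcop _ (dvd_mul_right _ _)))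
    have h1 : #(n * (c i * r)).divisors =
        #(n * (A * (A / a i))).divisors * ((e i + 1) * (#(G i).divisors * #r.divisors)) := by
      have hX : (n * (A * (A / a i))).Coprime (q i ^ e i * (G i * r)) :=
        (hAX.coprime_dvd_left hnA).mul_left (hAX.mul_left (hAX.coprime_dvd_left (hAa i)))
      rw [show n * (c i * r) = n * (A * (A / a i)) * (q i ^ e i * (G i * r)) by
          simp only [hc]; ring, hX.card_divisors_mul,
        ((hqG.mul_right hqr).pow_left _).card_divisors_mul, hGr.card_divisors_mul,
        Nat.divisors_prime_pow (hq i), card_map, card_range]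
    have h2 : ∀ f, #(q i ^ f * m i).divisors = (f + 1) * #(m i).divisors := fun f => by
      rw [Nat.Coprime.card_divisors_mul ((hqmc i).pow_left _), Nat.divisors_prime_pow (hq i),
        card_map, card_range]
    have h3 : #((∏ i, F i) * r).divisors =
        (R i + e i + 1) * #(m i).divisors * #(G i).divisors * #r.divisors := by
      rw [Nat.Coprime.card_divisors_mul (hrcop _ (dvd_mul_left _ _)), ← hFG i,
        Nat.Coprime.card_divisors_mul (hFGc i), hF, h2]
    simp only
    rw [h1, h2, h3, add_assoc, heR]
    ring

/-- Balanced tuples of every length exist. -/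
theorem exists_balancedTuple {n : ℕ} (hn : 0 < n) (N : ℕ) :
    ∃ a t : Fin N → ℕ, BalancedTuple n N a t := by
  induction N with
  | zero =>
    exact ⟨Fin.elim0, Fin.elim0, ⟨fun i => i.elim0, fun i => i.elim0, fun i => i.elim0,
      fun i => i.elim0, fun i => i.elim0⟩⟩
  | succ N ih =>
    obtain ⟨a, t, h⟩ := ih
    set A := 2 * n * ∏ i, a i with hAdef
    have hA : 0 < A := Nat.mul_pos (by omega) (prod_pos fun i _ => h.pos i)
    have haA : ∀ i, a i ∣ A := fun i => (dvd_prod_of_mem a (mem_univ i)).mul_left _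
    have hnA : n ∣ A := (dvd_mul_left n 2).mul_right _
    set τ : Fin N → ℕ := fun i => t i * #(n * (A * (A / a i))).divisors with hτ
    have hτ0 : ∀ i, 0 < τ i := fun i => Nat.mul_pos (h.mult_pos i)
      (card_pos.2 (Nat.nonempty_divisors.2 (Nat.mul_pos hn (Nat.mul_pos hA
        (Nat.div_pos (Nat.le_of_dvd hA (haA i)) (h.pos i)))).ne'))
    set R : Fin N → ℕ := fun i => 2 * ∏ j ∈ univ.erase i, τ j with hR
    have hR2 : ∀ i, 2 ≤ R i := fun i =>
      Nat.le_mul_of_pos_right _ (prod_pos fun j _ => hτ0 j)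
    have hτR : ∀ i, τ i * R i = 2 * ∏ j, τ j := fun i => by
      rw [← mul_prod_erase univ τ (mem_univ i), hR]
      ring
    obtain ⟨D, q, m, hq, hD, hqm, hcop, hpair⟩ := exists_translate_eq_mul_prime_pow (R := R) hA haA
      (fun i j hij => (h.sub_dvd i j hij).trans (haA i)) h.injective
    obtain ⟨b, B, W, hB, hW, hb, hbcop, hbW⟩ := exists_common_multiple (n := n) hA
      ((dvd_mul_right 2 n).mul_right _) hnA haA hR2 hq hqm hcop hpair
    have h' := h.translate hD fun i =>
      ((hcop i).coprime_dvd_left hnA).symm.mul_right ((hcop i).coprime_dvd_left (haA i)).symm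
    refine ⟨_, _, h'.cons hn (W := 2 * (∏ j, τ j) * W) hB
      (Nat.mul_pos (Nat.mul_pos two_pos (prod_pos fun j _ => hτ0 j)) hW) hb hbcop fun i => ?_⟩
    rw [mul_assoc, hbW, ← hτR i, hτ]
    ring

lemma Int.not_dvd_sub_of_lt {a b q : ℕ} (hab : a ≠ b) (ha : a < q) (hb : b < q) :
    ¬ (q : ℤ) ∣ (a : ℤ) - b := fun h => by
  have h1 := Int.eq_zero_of_abs_lt_dvd h (by rw [abs_lt]; omega)
  omega

/-- Along a suitable progression the numbers `a i * x + 1` are prime powers with prescribed exponent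
times the values of admissible linear forms. -/
lemma exists_admissibleForms {N : ℕ} {a t : Fin N → ℕ} (B : ℕ) (hB : 0 < B)
    (ha : ∀ i, 0 < a i) (hinj : Function.Injective a) (haB : ∀ i, a i ≤ B) (ht : ∀ i, 2 ≤ t i) :
    ∃ (k x₀ M : ℕ) (q u v : Fin N → ℕ), 0 < k ∧ 2 * N ≤ 2 ^ k ∧ B ≤ 2 ^ k ∧
      (∀ i, (q i).Prime ∧ B < q i ∧ q i ≤ 2 ^ k) ∧ AdmissibleForms N k u v ∧
      ∀ i y, a i * (x₀ + M * y) + 1 = q i ^ (t i - 1) * (u i + v i * y) := by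
  obtain ⟨q, hqinj, hq⟩ := exists_injective_prime_gt N B
  set k := ∑ i, q i + 2 * N + B
  have hk : k ≤ 2 ^ k := k.lt_two_pow_self.le
  have hqk : ∀ i, q i ≤ 2 ^ k := fun i => by
    have := single_le_sum (f := q) (fun _ _ => Nat.zero_le _) (mem_univ i)
    omega
  have ht1 : ∀ i, t i - 1 + 1 = t i := fun i => by have := ht i; omega
  set P := (primesBetween 0 (2 ^ k)).filter fun p => ∀ i, p ≠ q i
  set D := ∏ p ∈ P, p
  have hP : ∀ p ∈ P, p.Prime ∧ p ≤ 2 ^ k ∧ ∀ i, p ≠ q i := fun p hp => by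
    have h1 := mem_filter.1 hp
    have h2 := mem_primesBetween.1 h1.1
    exact ⟨h2.2, h2.1.2, h1.2⟩
  have hD0 : 0 < D := prod_pos fun p hp => (hP p hp).1.pos
  set M := D * ∏ i, q i ^ t i
  have hM0 : 0 < M := Nat.mul_pos hD0 (prod_pos fun i _ => pow_pos (hq i).1.pos _)
  have hqM : ∀ i, q i ^ t i ∣ M := fun i =>
    (dvd_prod_of_mem (fun i => q i ^ t i) (mem_univ i)).mul_left _
  have hqM' : ∀ i, q i ^ (t i - 1) ∣ M := fun i => (pow_dvd_pow _ (Nat.sub_le _ _)).trans (hqM i)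
  have hqa : ∀ i j, ¬ q i ∣ a j := fun i j h =>
    ((Nat.le_of_dvd (ha j) h).trans (haB j)).not_gt (hq i).2
  have hqD : ∀ i, (q i).Coprime D := fun i => Nat.Coprime.prod_right fun p hp =>
    (Nat.coprime_primes (hq i).1 (hP p hp).1).2 ((hP p hp).2.2 i).symm
  obtain ⟨x₁, hx₁⟩ := exists_forall_mul_modEq (c := fun i => a i * D) (m := fun i => q i ^ t i)
    (fun i => q i ^ (t i - 1) - 1) (fun i => pow_ne_zero _ (hq i).1.ne_zero)
    (fun i => Nat.Coprime.pow_right _ (Nat.coprime_comm.1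
      (((hq i).1.coprime_iff_not_dvd.2 (hqa i i)).mul_right (hqD i))))
    (fun i j hij => Nat.Coprime.pow _ _
      ((Nat.coprime_primes (hq i).1 (hq j).1).2 fun h => hij (hqinj h)))
  set x₀ := D * x₁ + M
  have hmod : ∀ i y, a i * (x₀ + M * y) + 1 ≡ q i ^ (t i - 1) [MOD q i ^ t i] := fun i y => by
    have h1 := (hx₁ i).add_right 1
    rw [Nat.sub_add_cancel (Nat.one_le_pow _ _ (hq i).1.pos)] at h1
    refine Nat.ModEq.trans ?_ h1
    have h2 : a i * (x₀ + M * y) + 1 = a i * D * x₁ + 1 + M * (a i * (y + 1)) := by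
      simp only [x₀]
      ring
    rw [h2]
    have h3 : M * (a i * (y + 1)) ≡ 0 [MOD q i ^ t i] :=
      Nat.modEq_zero_iff_dvd.2 ((hqM i).mul_right _)
    simpa using h3.add_left (a i * D * x₁ + 1)
  have hu : ∀ i, q i ^ (t i - 1) ∣ a i * x₀ + 1 := fun i => by
    have h1 := hmod i 0
    rw [mul_zero, add_zero] at h1
    exact ((h1.of_dvd (pow_dvd_pow _ (Nat.sub_le _ _))).dvd_iff dvd_rfl).2 dvd_rfl
  have hv : ∀ i, q i ^ (t i - 1) ∣ a i * M := fun i => (hqM' i).mul_left _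
  choose u hu using hu
  choose v hv using hv
  have hform : ∀ i y, a i * (x₀ + M * y) + 1 = q i ^ (t i - 1) * (u i + v i * y) := fun i y => by
    linear_combination hu i + y * hv i
  have hbig : ∀ p : ℕ, p.Prime → 2 ^ k < p → ¬ p ∣ M := fun p hp hkp hd => by
    rcases hp.dvd_mul.1 hd with h | h
    · obtain ⟨r, hr, hpr⟩ := (hp.prime.dvd_finsetProd_iff _).1 h
      have h1 := Nat.le_of_dvd (hP r hr).1.pos hpr
      have h2 := (hP r hr).2.1
      omega
    · obtain ⟨i, -, hpr⟩ := (hp.prime.dvd_finsetProd_iff _).1 h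
      have h1 := Nat.le_of_dvd (hq i).1.pos (hp.dvd_of_dvd_pow hpr)
      have h2 := hqk i
      omega
  refine ⟨k, x₀, M, q, u, v, by omega, by omega, by omega,
    fun i => ⟨(hq i).1, (hq i).2, hqk i⟩, ⟨fun i => ?_, fun p hp hpk i y hd => ?_,
    fun p hp hkp i hd => ?_, fun p hp hkp i j hij hd => ?_⟩, hform⟩
  · have h1 : q i ^ (t i - 1) * q i ≤ M := by
      rw [← pow_succ, ht1]
      exact Nat.le_of_dvd hM0 (hqM i)
    have h2 : q i ^ (t i - 1) * q i < q i ^ (t i - 1) * u i := by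
      rw [← hu]
      have : M ≤ a i * x₀ := by
        calc M ≤ x₀ := Nat.le_add_left _ _
          _ ≤ _ := Nat.le_mul_of_pos_left _ (ha i)
      omega
    have h3 := Nat.lt_of_mul_lt_mul_left h2
    have := (hq i).1.two_le
    omega
  · have hdx : p ∣ a i * (x₀ + M * y) + 1 := by
      rw [hform]
      exact hd.mul_left _
    by_cases hpq : ∀ j, p ≠ q j
    · have hpD : p ∣ D := dvd_prod_of_mem (fun p => p)
        (mem_filter.2 ⟨mem_primesBetween.2 ⟨⟨hp.pos, hpk⟩, hp⟩, hpq⟩)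
      have hpx : p ∣ a i * (x₀ + M * y) := Dvd.dvd.mul_left
        (dvd_add (dvd_add (hpD.mul_right _) (hpD.mul_right _)) ((hpD.mul_right _).mul_right _)) _
      exact hp.one_lt.ne' (Nat.dvd_one.1 ((Nat.dvd_add_right hpx).1 hdx))
    · push Not at hpq
      obtain ⟨j, rfl⟩ := hpq
      by_cases hij : i = j
      · subst hij
        have h1 : q i ^ t i ∣ a i * (x₀ + M * y) + 1 := by
          rw [hform, ← ht1 i, Nat.add_sub_cancel, pow_succ]
          exact mul_dvd_mul_left _ hd
        have h2 := ((hmod i y).dvd_iff dvd_rfl).1 h1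
        have h3 := (Nat.pow_dvd_pow_iff_le_right (hq i).1.one_lt).1 h2
        have := ht i
        omega
      · have hdx' : q j ∣ a j * (x₀ + M * y) + 1 := by
          rw [hform]
          exact (dvd_pow_self _ (by have := ht j; omega)).mul_right _
        have h1 : (q j : ℤ) ∣ a i * (x₀ + M * y) + 1 := by exact_mod_cast hdx
        have h2 : (q j : ℤ) ∣ a j * (x₀ + M * y) + 1 := by exact_mod_cast hdx'
        refine Int.not_dvd_sub_of_lt (hinj.ne (Ne.symm hij)) ((haB j).trans_lt (hq j).2)
          ((haB i).trans_lt (hq j).2) ?_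
        have h3 := dvd_sub (h1.mul_left (a j : ℤ)) (h2.mul_left (a i : ℤ))
        rwa [show (a j : ℤ) * (a i * (x₀ + M * y) + 1) - a i * (a j * (x₀ + M * y) + 1) = a j - a i
          by ring] at h3
  · have h1 : p ∣ a i * M := by
      rw [hv]
      exact hd.mul_left _
    rcases hp.dvd_mul.1 h1 with h | h
    · have := Nat.le_of_dvd (ha i) h
      have := haB i
      omega
    · exact hbig p hp hkp h
  · have hui : (q i ^ (t i - 1) * u i : ℤ) = a i * x₀ + 1 := by exact_mod_cast (hu i).symm
    have huj : (q j ^ (t j - 1) * u j : ℤ) = a j * x₀ + 1 := by exact_mod_cast (hu j).symm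
    have hvi : (q i ^ (t i - 1) * v i : ℤ) = a i * M := by exact_mod_cast (hv i).symm
    have hvj : (q j ^ (t j - 1) * v j : ℤ) = a j * M := by exact_mod_cast (hv j).symm
    have h1 : (p : ℤ) ∣ M * ((a j : ℤ) - a i) := by
      have h2 : (M : ℤ) * ((a j : ℤ) - a i) =
          q i ^ (t i - 1) * q j ^ (t j - 1) * ((u i : ℤ) * v j - (u j : ℤ) * v i) := by
        calc (M : ℤ) * ((a j : ℤ) - a i) =
              (a i * x₀ + 1) * (a j * M) - (a j * x₀ + 1) * (a i * M) := by ring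
          _ = _ := by
            rw [← hui, ← huj, ← hvi, ← hvj]
            ring
      rw [h2]
      exact hd.mul_left _
    rcases (Nat.prime_iff_prime_int.1 hp).dvd_mul.1 h1 with h | h
    · exact hbig p hp hkp (by exact_mod_cast h)
    · have hi := haB i
      have hj := haB j
      exact Int.not_dvd_sub_of_lt (hinj.ne hij.symm) (by omega) (by omega) h

/-- For every positive integer `n`, there are infinitely many positive integers `x`
with `d(x) = d(x + n)`. -/
theorem stmt_7 (n : ℕ) (hn : 0 < n) :
    {x : ℕ | 0 < x ∧ x.divisors.card = (x + n).divisors.card}.Infinite := by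
  obtain ⟨a, t₀, h₀⟩ := exists_balancedTuple hn (2 ^ 12)
  have h := h₀.const_mul two_pos
  set t : Fin (2 ^ 12) → ℕ := fun i => 2 * t₀ i with ht
  have ht2 : ∀ i, 2 ≤ t i := fun i => by have := h₀.mult_pos i; simp only [ht]; omega
  have hprod : 0 < ∏ i, a i := prod_pos fun i _ => h.pos i
  have haprod : ∀ i, a i ≤ ∏ i, a i := fun i =>
    Nat.le_of_dvd hprod (dvd_prod_of_mem a (mem_univ i))
  obtain ⟨k, x₀, M, q, u, v, hk, hNk, hBk, hq, hforms, hval⟩ :=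
    exists_admissibleForms (n * ∏ i, a i) (Nat.mul_pos hn hprod) h.pos h.injective
      (fun i => (haprod i).trans (Nat.le_mul_of_pos_left _ hn)) ht2
  refine Set.infinite_of_forall_exists_gt fun X => ?_
  obtain ⟨y, i, j, hij, hX, hcard⟩ := hforms.exists_card_divisors_eq (by positivity) hk hNk
    (s := 19) (by norm_num) (by norm_num) (by norm_num) X
  wlog hlt : a i < a j generalizing i j
  · exact this j i hij.symm hcard.symm
      (lt_of_le_of_ne (not_lt.1 hlt) fun h' => hij (h.injective h').symm)
  have hdi := h.sub_dvd i j hlt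
  have hdj : a j - a i ∣ a j := (Nat.dvd_sub_iff_left hlt.le hdi).1 dvd_rfl
  have hpos : 0 < a j - a i := Nat.sub_pos_of_lt hlt
  have hdiv : ∀ l l', a j - a i ∣ a l → #(n * (a l / (a j - a i)) *
      (a l' * (x₀ + M * y) + 1)).divisors =
      t l' * #(n * (a l / (a j - a i))).divisors * #(u l' + v l' * y).divisors := by
    intro l l' hl
    have hc0 : 0 < n * (a l / (a j - a i)) :=
      Nat.mul_pos hn (Nat.div_pos (Nat.le_of_dvd (h.pos l) hl) hpos)
    have hcB : n * (a l / (a j - a i)) ≤ n * ∏ i, a i :=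
      Nat.mul_le_mul_left n ((Nat.div_le_self _ _).trans (haprod l))
    have hcq : (n * (a l / (a j - a i))).Coprime (q l') := Nat.coprime_comm.1 <|
      (hq l').1.coprime_iff_not_dvd.2 fun hd =>
        ((Nat.le_of_dvd hc0 hd).trans hcB).not_gt (hq l').2.1
    have hcv : (n * (a l / (a j - a i))).Coprime (u l' + v l' * y) :=
      Nat.coprime_of_dvd fun p hp hpc => hforms.not_dvd_value p hp
        ((Nat.le_of_dvd hc0 hpc).trans (hcB.trans hBk)) l' y
    have hqv : (q l').Coprime (u l' + v l' * y) :=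
      (hq l').1.coprime_iff_not_dvd.2 (hforms.not_dvd_value _ (hq l').1 (hq l').2.2 l' y)
    rw [hval, ((hcq.pow_right _).mul_right hcv).card_divisors_mul,
      (hqv.pow_left _).card_divisors_mul, Nat.divisors_prime_pow (hq l').1, card_map, card_range,
      Nat.sub_add_cancel (by have := ht2 l'; omega)]
    ring
  obtain ⟨ci, hci⟩ := hdi
  obtain ⟨cj, hcj⟩ := hdj
  have hi := hdiv i j ⟨ci, hci⟩
  have hj := hdiv j i ⟨cj, hcj⟩
  have hbal := h.balanced i j hlt
  have hXj : X < n * (a i / (a j - a i)) * (a j * (x₀ + M * y) + 1) := by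
    have h1 : 0 < n * (a i / (a j - a i)) :=
      Nat.mul_pos hn (Nat.div_pos (Nat.le_of_dvd (h.pos i) ⟨ci, hci⟩) hpos)
    refine (hX j).trans_le ?_
    rw [hval]
    exact (Nat.le_mul_of_pos_left _ (pow_pos (hq j).1.pos _)).trans (Nat.le_mul_of_pos_left _ h1)
  have hadd : n * (a i / (a j - a i)) * (a j * (x₀ + M * y) + 1) + n =
      n * (a j / (a j - a i)) * (a i * (x₀ + M * y) + 1) := by
    have hcc : cj = ci + 1 := by
      refine Nat.eq_of_mul_eq_mul_left hpos ?_
      rw [← hcj, mul_add, ← hci]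
      omega
    have hi' : a i / (a j - a i) = ci := Nat.div_eq_of_eq_mul_right hpos hci
    have hj' : a j / (a j - a i) = cj := Nat.div_eq_of_eq_mul_right hpos hcj
    have hcross : ci * a j = cj * a i := by
      calc ci * a j = ci * ((a j - a i) * cj) := by rw [← hcj]
        _ = cj * ((a j - a i) * ci) := by ring
        _ = cj * a i := by rw [← hci]
    rw [hi', hj']
    linear_combination (n * (x₀ + M * y)) * hcross - n * hcc
  refine ⟨_, ⟨(Nat.zero_le _).trans_lt hXj, ?_⟩, hXj⟩
  rw [hadd, hi, hj, hcard, hbal]
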